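/- Let n ≥ 1, let T be an n-periodic 2-triangulation on the 4n-gon, and let e ∈ T be a 2-relevant edge with rotation orbit ẽ = {e, e+n, e+2n, e+3n}. Then there exists an edge f of the 4n-gon with f ∉ T, with rotation orbit f̃ = {f, f+n, f+2n, f+3n}, such that (T ∖ ẽ) ∪ f̃ is again an n-periodic 2-triangulation on the 4n-gon. -/

import Mathlib

/- Edges on the universal cover of the half-cylinder, modeled by the integers.
   An edge is an unordered pair of distinct integers, represented as an ordered
   pair `(a, b)` with `a < b` (validity). -/

namespace Multitriangulation

abbrev Edge := ℤ × ℤ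

/-- Translate an edge by `t`: `[a,b] + t = [a+t, b+t]`. -/
def shift (e : Edge) (t : ℤ) : Edge := (e.1 + t, e.2 + t)

/-- Two edges (as unordered pairs of integers) cross:
their endpoints strictly interleave. -/
def Crosses (e f : Edge) : Prop :=
  (min e.1 e.2 < min f.1 f.2 ∧ min f.1 f.2 < max e.1 e.2 ∧ max e.1 e.2 < max f.1 f.2) ∨
  (min f.1 f.2 < min e.1 e.2 ∧ min e.1 e.2 < max f.1 f.2 ∧ max f.1 f.2 < max e.1 e.2)

/-- A finite set of edges is an `l`-crossing if it consists of `l` pairwise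
crossing edges. -/
def IsCrossing (l : ℕ) (S : Finset Edge) : Prop :=
  S.card = l ∧ ∀ e ∈ S, ∀ f ∈ S, e ≠ f → Crosses e f

/-- A set of edges is `l`-crossing-free if no `l` of its edges pairwise cross. -/
def CrossingFree (l : ℕ) (E : Set Edge) : Prop :=
  ¬ ∃ S : Finset Edge, ↑S ⊆ E ∧ IsCrossing l S

/-- A set of edges is `n`-periodic if `e ∈ E ↔ e + n ∈ E`. -/
def Periodic (n : ℕ) (E : Set Edge) : Prop := ∀ e, e ∈ E ↔ shift e (n : ℤ) ∈ E

/-- All members are genuine edges `[a,b]` with `a < b`. -/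
def ValidEdges (E : Set Edge) : Prop := ∀ e ∈ E, e.1 < e.2

/-- An `n`-periodic `k`-triangulation on `ℤ`: an `n`-periodic
`(k+1)`-crossing-free set of edges that is maximal under inclusion among
`n`-periodic `(k+1)`-crossing-free sets of edges. -/
def IsTriangulation (n k : ℕ) (T : Set Edge) : Prop :=
  ValidEdges T ∧ Periodic n T ∧ CrossingFree (k+1) T ∧
  ∀ T', ValidEdges T' → Periodic n T' → CrossingFree (k+1) T' → T ⊆ T' → T' = T

/-- Interleaving of representatives `0 ≤ a < b < m`, `0 ≤ c < d < m`:
`a<c<b<d` or `c<a<d<b` (formulated symmetrically via `min`/`max`). -/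
def crossIndex (a b c d : ℕ) : Prop :=
  (min a b < min c d ∧ min c d < max a b ∧ max a b < max c d) ∨
  (min c d < min a b ∧ min a b < max c d ∧ max c d < max a b)

/-- Two edges of the `m`-gon (vertices labeled by `ZMod m`) cross: their
endpoints interleave in cyclic order, via the representatives in `[0, m)`. -/
def PolyCrosses {m : ℕ} (e f : Sym2 (ZMod m)) : Prop :=
  ∃ x y z w : ZMod m, e = s(x, y) ∧ f = s(z, w) ∧ crossIndex x.val y.val z.val w.val

/-- A finite set of polygon edges is an `l`-crossing if it consists of `l`
pairwise crossing edges. -/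
def PolyIsCrossing {m : ℕ} (l : ℕ) (S : Finset (Sym2 (ZMod m))) : Prop :=
  S.card = l ∧ ∀ e ∈ S, ∀ f ∈ S, e ≠ f → PolyCrosses e f

/-- A set of polygon edges is `l`-crossing-free. -/
def PolyCrossingFree {m : ℕ} (l : ℕ) (E : Set (Sym2 (ZMod m))) : Prop :=
  ¬ ∃ S : Finset (Sym2 (ZMod m)), ↑S ⊆ E ∧ PolyIsCrossing l S

/-- Invariance under the rotation `v ↦ v + n`. -/
def PolyPeriodic (n : ℕ) {m : ℕ} (T : Set (Sym2 (ZMod m))) : Prop :=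
  ∀ e, e ∈ T ↔ Sym2.map (· + (n : ZMod m)) e ∈ T

/-- All members are genuine edges (pairs of distinct vertices). -/
def PolyValid {m : ℕ} (T : Set (Sym2 (ZMod m))) : Prop := ∀ e ∈ T, ¬ e.IsDiag

/-- A `2`-triangulation on the `m`-gon: a 3-crossing-free set of edges,
maximal under inclusion among 3-crossing-free sets of edges. -/
def IsPolyTriangulation {m : ℕ} (T : Set (Sym2 (ZMod m))) : Prop :=
  PolyValid T ∧ PolyCrossingFree 3 T ∧
  ∀ T', PolyValid T' → PolyCrossingFree 3 T' → T ⊆ T' → T' = T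

/-- An edge of the `4n`-gon is 2-relevant: its endpoints have representatives
`0 ≤ a < b < 4n` with `2 < b − a < 4n − 2`. -/
def PolyRelevant (n : ℕ) (e : Sym2 (ZMod (4 * n))) : Prop :=
  ∃ a b : ℕ, a < b ∧ b < 4 * n ∧
    e = s(((a : ZMod (4 * n))), ((b : ZMod (4 * n)))) ∧
    2 < b - a ∧ b - a < 4 * n - 2

/-- The rotation orbit `ẽ = {e, e+n, e+2n, e+3n}` of an edge of the `4n`-gon. -/
def tilde (n : ℕ) (e : Sym2 (ZMod (4 * n))) : Set (Sym2 (ZMod (4 * n))) :=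
  {e, Sym2.map (· + ((n : ℕ) : ZMod (4 * n))) e,
    Sym2.map (· + ((2 * n : ℕ) : ZMod (4 * n))) e,
    Sym2.map (· + ((3 * n : ℕ) : ZMod (4 * n))) e}

/-- An `n`-periodic 2-triangulation on the `4n`-gon. -/
def IsPeriodicPolyTriangulation (n : ℕ) (T : Set (Sym2 (ZMod (4 * n)))) : Prop :=
  IsPolyTriangulation T ∧ PolyPeriodic n T

section PartA
/-- Cyclic lift of a 3-crossing-free edge set of the `N`-gon to `ℤ`. -/
structure Sys (N : ℤ) (E : ℤ → ℤ → Prop) : Prop where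
  hN : 5 ≤ N
  symm : ∀ {a b}, E a b → E b a
  per : ∀ {a b}, E a b → E a (b + N)
  per' : ∀ {a b}, E a b → E a (b - N)
  cf : ∀ {a1 a2 a3 b1 b2 b3 : ℤ}, a1 < a2 → a2 < a3 → a3 < b1 → b1 < b2 → b2 < b3 →
    b3 < a1 + N → E a1 b1 → E a2 b2 → E a3 b3 → False

/-- Maximality of the lifted edge set. -/
def Mx (N : ℤ) (E : ℤ → ℤ → Prop) : Prop :=
  ∀ a b : ℤ, a < b → b < a + N → ¬ E a b → ∃ g1 h1 g2 h2, a < g1 ∧ g1 < h1 ∧ h1 < b ∧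
    b < g2 ∧ g2 < h2 ∧ h2 < a + N ∧ E g1 g2 ∧ E h1 h2

variable {N : ℤ} {E : ℤ → ℤ → Prop}

theorem Sys.perL (h : Sys N E) {a b : ℤ} (e : E a b) : E (a + N) b := h.symm (h.per (h.symm e))
theorem Sys.perL' (h : Sys N E) {a b : ℤ} (e : E a b) : E (a - N) b := h.symm (h.per' (h.symm e))

theorem Sys.cast (_ : Sys N E) {a b c d : ℤ} (e : E a b) (h1 : a = c) (h2 : b = d) : E c d := by
  subst h1 h2; exact e

/-- if the difference of endpoints is a common shift by a multiple of `N`. -/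
theorem Sys.up (h : Sys N E) {a b : ℤ} (e : E a b) : E (a + N) (b + N) := h.perL (h.per e)
theorem Sys.down (h : Sys N E) {a b : ℤ} (e : E a b) : E (a - N) (b - N) := h.perL' (h.per' e)

theorem Sys.refl_neg (h : Sys N E) : Sys N (fun a b => E (-a) (-b)) where
  hN := h.hN
  symm := fun e => h.symm e
  per := fun {a b} e => h.cast (h.per' e) rfl (by ring)
  per' := fun {a b} e => h.cast (h.per e) rfl (by ring)
  cf := by
    intro a1 a2 a3 b1 b2 b3 h1 h2 h3 h4 h5 h6 e1 e2 e3
    exact h.cf (a1 := -b3) (a2 := -b2) (a3 := -b1) (b1 := -a3) (b2 := -a2) (b3 := -a1)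
      (by omega) (by omega) (by omega) (by omega) (by omega) (by omega)
      (h.symm e3) (h.symm e2) (h.symm e1)

theorem Mx.refl_neg (h : Sys N E) (mx : Mx N E) : Mx N (fun a b => E (-a) (-b)) := by
  intro a b hab hb hne
  obtain ⟨g1, h1, g2, h2, l1, l2, l3, l4, l5, l6, e1, e2⟩ :=
    mx (-b) (-a) (by omega) (by omega) (fun e => hne (h.symm e))
  -- order: -b < g1 < h1 < -a < g2 < h2 < -b + N
  refine ⟨-h1, -g1, -h2 + N, -g2 + N, ?_, ?_, ?_, ?_, ?_, ?_, ?_, ?_⟩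
  · omega
  · omega
  · omega
  · omega
  · omega
  · omega
  · exact h.cast (h.per' e2) (by ring) (by ring)
  · exact h.cast (h.per' e1) (by ring) (by ring)

theorem claim1 (h : Sys N E) (mx : Mx N E) {o p q : ℤ} (hp : o + 2 ≤ p) (hpq : p < q)
    (hq : q ≤ o + N - 2) (ep : E o p) (eq : E o q) (emp : ∀ w, p < w → w < q → ¬ E o w) :
    ∃ r, q < r ∧ r < o + N ∧ E p r := by
  by_contra hno
  push Not at hno
  let P : ℤ → Prop := fun s => ∃ g1 h1 h2, q ≤ g1 ∧ g1 < h1 ∧ h1 < s ∧ s < o + N ∧ o + N < h2 ∧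
    h2 < p + N ∧ E g1 (o + N) ∧ E h1 h2
  have ep' : E p (o + N) := h.per (h.symm ep)
  have eq' : E q (o + N) := h.per (h.symm eq)
  have blk : ∀ s, q < s → s < o + N → ¬ P s → ∃ g1 h1 g2 h2, p < g1 ∧ g1 < h1 ∧ h1 < s ∧
    s < g2 ∧ g2 < h2 ∧ h2 < p + N ∧ E g1 g2 ∧ E h1 h2 ∧ g2 < o + N := by
    intro s hs1 hs2 hP
    obtain ⟨g1, h1, g2, h2, l1, l2, l3, l4, l5, l6, e1, e2⟩ :=
      mx p s (by omega) (by omega) (hno s hs1 hs2)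
    refine ⟨g1, h1, g2, h2, l1, l2, l3, l4, l5, l6, e1, e2, ?_⟩
    by_contra hg
    rcases lt_or_eq_of_le (not_lt.mp hg) with hg | hg
    · exact h.cf l1 l2 (show h1 < o + N by omega) hg l5 l6 ep' e1 e2
    · subst hg
      apply hP
      refine ⟨g1, h1, h2, ?_, l2, l3, hs2, l5, l6, e1, e2⟩
      by_contra hlt
      exact emp g1 l1 (by omega) (h.cast (h.per' (h.symm (h.symm (h.perL' (h.symm e1)))))
        (by ring) rfl |> fun e => by
          have := h.per e
          simpa using this)
  have hP1 : P (o + N - 1) := by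
    by_contra hP
    obtain ⟨g1, h1, g2, h2, l1, l2, l3, l4, l5, l6, e1, e2, l7⟩ :=
      blk (o + N - 1) (by omega) (by omega) hP
    omega
  obtain ⟨s, hs, hmin⟩ := Int.exists_least_of_bdd (P := P)
    ⟨q, fun z ⟨g1, h1, h2, a1, a2, a3, _⟩ => by omega⟩ ⟨_, hP1⟩
  obtain ⟨g1', h1', h2', m1, m2, m3, m4, m5, m6, f1, f2⟩ := hs
  have hnP : ¬ P (s - 1) := fun hp => by have := hmin _ hp; omega
  have hh : h1' = s - 1 := by
    by_contra hne
    exact hnP ⟨g1', h1', h2', m1, m2, by omega, by omega, m5, m6, f1, f2⟩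
  obtain ⟨g1, h1, g2, h2, l1, l2, l3, l4, l5, l6, e1, e2, l7⟩ :=
      blk (s - 1) (by omega) (by omega) hnP
  have hh2 : h2' ≤ h2 := by
    by_contra hlt
    exact h.cf l2 (show h1 < h1' by omega) (by omega) l5 (by omega : h2 < h2') (by omega) e1 e2 f2
  by_cases hq1 : q < h1
  · exact hnP ⟨q, h1, h2, le_refl _, hq1, l3, by omega, by omega, l6, eq', e2⟩
  · exact h.cf (show g1 < g1' by omega) m2 (show h1' < g2 by omega) l7 m5 (by omega) e1 f1 f2

theorem claim1' (h : Sys N E) (mx : Mx N E) {o p q : ℤ} (hp : o + 2 ≤ p) (hpq : p < q)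
    (hq : q ≤ o + N - 2) (ep : E o p) (eq : E o q) (emp : ∀ w, p < w → w < q → ¬ E o w) :
    ∃ r, o < r ∧ r < p ∧ E r q := by
  obtain ⟨r, h1, h2, e⟩ := claim1 h.refl_neg (mx.refl_neg h) (o := -o) (p := N - q) (q := N - p)
    (by omega) (by omega) (by omega) (h.cast (h.per' eq) (by ring) (by ring))
    (h.cast (h.per' ep) (by ring) (by ring))
    (fun w w1 w2 e => emp (-w + N) (by omega) (by omega) (h.cast (h.per e) (by ring) rfl))
  exact ⟨-r + N, by omega, by omega, h.cast (h.symm (h.up e)) (by ring) (by ring)⟩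

/-- A 2-star of the edge set: a bi-infinite increasing sequence, `5`-periodic modulo `N`. -/
structure IsStar (N : ℤ) (E : ℤ → ℤ → Prop) (r : ℤ → ℤ) : Prop where
  mono : ∀ i, r i < r (i + 1)
  per : ∀ i, r (i + 5) = r i + N
  edge : ∀ i, E (r i) (r (i + 2))
  emp : ∀ i w, r (i + 2) < w → w < r (i + 3) → ¬ E (r i) w

theorem star_mk (h : Sys N E) {r0 r1 r2 r3 r4 : ℤ} (h01 : r0 < r1) (h12 : r1 < r2)
    (h23 : r2 < r3) (h34 : r3 < r4) (h40 : r4 < r0 + N)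
    (e02 : E r0 r2) (e13 : E r1 r3) (e24 : E r2 r4) (e30 : E r3 r0) (e41 : E r4 r1)
    (p0 : ∀ w, r2 < w → w < r3 → ¬ E r0 w) (p1 : ∀ w, r3 < w → w < r4 → ¬ E r1 w)
    (p2 : ∀ w, r4 < w → w < r0 + N → ¬ E r2 w) (p3 : ∀ w, r0 < w → w < r1 → ¬ E r3 w)
    (p4 : ∀ w, r1 < w → w < r2 → ¬ E r4 w) :
    ∃ r, IsStar N E r ∧ r 0 = r0 ∧ r 1 = r1 ∧ r 2 = r2 ∧ r 3 = r3 ∧ r 4 = r4 := by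
  let r : ℤ → ℤ := fun i => (if i % 5 = 0 then r0 else if i % 5 = 1 then r1 else
    if i % 5 = 2 then r2 else if i % 5 = 3 then r3 else r4) + N * (i / 5)
  have q : ∀ i, (i % 5 = 0 ∧ r i = r0 + N * (i / 5) ∧ r (i + 1) = r1 + N * (i / 5) ∧
        r (i + 2) = r2 + N * (i / 5) ∧ r (i + 3) = r3 + N * (i / 5)) ∨
      (i % 5 = 1 ∧ r i = r1 + N * (i / 5) ∧ r (i + 1) = r2 + N * (i / 5) ∧
        r (i + 2) = r3 + N * (i / 5) ∧ r (i + 3) = r4 + N * (i / 5)) ∨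
      (i % 5 = 2 ∧ r i = r2 + N * (i / 5) ∧ r (i + 1) = r3 + N * (i / 5) ∧
        r (i + 2) = r4 + N * (i / 5) ∧ r (i + 3) = r0 + N + N * (i / 5)) ∨
      (i % 5 = 3 ∧ r i = r3 + N * (i / 5) ∧ r (i + 1) = r4 + N * (i / 5) ∧
        r (i + 2) = r0 + N + N * (i / 5) ∧ r (i + 3) = r1 + N + N * (i / 5)) ∨
      (i % 5 = 4 ∧ r i = r4 + N * (i / 5) ∧ r (i + 1) = r0 + N + N * (i / 5) ∧
        r (i + 2) = r1 + N + N * (i / 5) ∧ r (i + 3) = r2 + N + N * (i / 5)) := by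
    intro i
    have hi : i % 5 = 0 ∨ i % 5 = 1 ∨ i % 5 = 2 ∨ i % 5 = 3 ∨ i % 5 = 4 := by omega
    have key : ∀ j, r j = (if j % 5 = 0 then r0 else if j % 5 = 1 then r1 else
      if j % 5 = 2 then r2 else if j % 5 = 3 then r3 else r4) + N * (j / 5) := fun j => rfl
    rcases hi with hi | hi | hi | hi | hi
    · left
      refine ⟨hi, ?_, ?_, ?_, ?_⟩
      · rw [key, hi]; simp
      · rw [key, show (i+1) % 5 = 1 by omega, show (i+1) / 5 = i/5 by omega]; simp
      · rw [key, show (i+2) % 5 = 2 by omega, show (i+2) / 5 = i/5 by omega]; simp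
      · rw [key, show (i+3) % 5 = 3 by omega, show (i+3) / 5 = i/5 by omega]; simp
    · right; left
      refine ⟨hi, ?_, ?_, ?_, ?_⟩
      · rw [key, hi]; simp
      · rw [key, show (i+1) % 5 = 2 by omega, show (i+1) / 5 = i/5 by omega]; simp
      · rw [key, show (i+2) % 5 = 3 by omega, show (i+2) / 5 = i/5 by omega]; simp
      · rw [key, show (i+3) % 5 = 4 by omega, show (i+3) / 5 = i/5 by omega]; simp
    · right; right; left
      refine ⟨hi, ?_, ?_, ?_, ?_⟩
      · rw [key, hi]; simp
      · rw [key, show (i+1) % 5 = 3 by omega, show (i+1) / 5 = i/5 by omega]; simp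
      · rw [key, show (i+2) % 5 = 4 by omega, show (i+2) / 5 = i/5 by omega]; simp
      · rw [key, show (i+3) % 5 = 0 by omega, show (i+3) / 5 = i/5 + 1 by omega]; simp; ring
    · right; right; right; left
      refine ⟨hi, ?_, ?_, ?_, ?_⟩
      · rw [key, hi]; simp
      · rw [key, show (i+1) % 5 = 4 by omega, show (i+1) / 5 = i/5 by omega]; simp
      · rw [key, show (i+2) % 5 = 0 by omega, show (i+2) / 5 = i/5 + 1 by omega]; simp; ring
      · rw [key, show (i+3) % 5 = 1 by omega, show (i+3) / 5 = i/5 + 1 by omega]; simp; ring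
    · right; right; right; right
      refine ⟨hi, ?_, ?_, ?_, ?_⟩
      · rw [key, hi]; simp
      · rw [key, show (i+1) % 5 = 0 by omega, show (i+1) / 5 = i/5 + 1 by omega]; simp; ring
      · rw [key, show (i+2) % 5 = 1 by omega, show (i+2) / 5 = i/5 + 1 by omega]; simp; ring
      · rw [key, show (i+3) % 5 = 2 by omega, show (i+3) / 5 = i/5 + 1 by omega]; simp; ring
  have sh : ∀ (c : ℤ) {a b : ℤ}, E a b → E a (b + N * c) := by
    intro c
    induction c using Int.induction_on with
    | zero => intro a b e; simpa using e
    | succ i ih => intro a b e; exact h.cast (h.per (ih e)) rfl (by ring)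
    | pred i ih => intro a b e; exact h.cast (h.per' (ih e)) rfl (by ring)
  have sh2 : ∀ (c : ℤ) {a b : ℤ}, E a b → E (a + N * c) (b + N * c) :=
    fun c a b e => h.symm (sh c (h.symm (sh c e)))
  have un : ∀ (c : ℤ) {a b : ℤ}, E (a + N * c) b → E a (b - N * c) := by
    intro c a b e
    exact h.cast (sh2 (-c) e) (by ring) (by ring)
  refine ⟨r, ⟨?_, ?_, ?_, ?_⟩, ?_, ?_, ?_, ?_, ?_⟩
  · intro i
    rcases q i with ⟨_, a, b, _, _⟩ | ⟨_, a, b, _, _⟩ | ⟨_, a, b, _, _⟩ | ⟨_, a, b, _, _⟩ | ⟨_, a, b, _, _⟩ <;>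
      rw [a, b] <;> linarith
  · intro i
    show _ + N * ((i+5)/5) = _ + N * (i/5) + N
    rw [show (i+5) % 5 = i % 5 by omega, show (i+5) / 5 = i/5 + 1 by omega]; ring
  · intro i
    rcases q i with ⟨_, a, _, b, _⟩ | ⟨_, a, _, b, _⟩ | ⟨_, a, _, b, _⟩ | ⟨_, a, _, b, _⟩ | ⟨_, a, _, b, _⟩ <;>
      rw [a, b] <;> apply sh2
    · exact e02
    · exact e13
    · exact e24
    · exact h.per e30
    · exact h.per e41
  · intro i w
    rcases q i with ⟨_, a, _, b, c⟩ | ⟨_, a, _, b, c⟩ | ⟨_, a, _, b, c⟩ | ⟨_, a, _, b, c⟩ | ⟨_, a, _, b, c⟩ <;>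
      rw [a, b, c] <;> intro w1 w2 e <;> have e' := un _ e
    · exact p0 _ (by linarith) (by linarith) e'
    · exact p1 _ (by linarith) (by linarith) e'
    · exact p2 _ (by linarith) (by linarith) e'
    · exact p3 _ (by linarith) (by linarith) (h.per' e')
    · exact p4 _ (by linarith) (by linarith) (h.per' e')
  all_goals simp [r]

theorem Sys.len2 (h : Sys N E) (mx : Mx N E) (a : ℤ) : E a (a + 2) := by
  by_contra hne
  obtain ⟨g1, h1, g2, h2, _⟩ := mx a (a + 2) (by omega) (by have := h.hN; omega) hne
  omega

theorem Sys.len1 (h : Sys N E) (mx : Mx N E) (a : ℤ) : E a (a + 1) := by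
  by_contra hne
  obtain ⟨g1, h1, g2, h2, _⟩ := mx a (a + 1) (by omega) (by have := h.hN; omega) hne
  omega

theorem star_exists (h : Sys N E) (mx : Mx N E) {a b : ℤ} (hab : a + 2 ≤ b) (hb : b ≤ a + N - 3)
    (e : E a b) : ∃ r, IsStar N E r ∧ r 0 = a ∧ r 2 = b := by
  have hq0 : E a (a + N - 2) := h.cast (h.per (h.symm (h.len2 mx (a - 2)))) (by ring) (by ring)
  obtain ⟨q, ⟨hq1, eq⟩, hq3⟩ := Int.exists_least_of_bdd (P := fun q => b < q ∧ E a q)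
    ⟨b, fun z hz => by omega⟩ ⟨a + N - 2, by omega, hq0⟩
  have hq2 : q ≤ a + N - 2 := hq3 _ ⟨by omega, hq0⟩
  have emp0 : ∀ w, b < w → w < q → ¬ E a w := fun w w1 w2 e => by
    have := hq3 w ⟨w1, e⟩; omega
  obtain ⟨x, x1, x2, ex⟩ := claim1 h mx hab hq1 hq2 e eq emp0
  obtain ⟨y, y1, y2, ey⟩ := claim1' h mx hab hq1 hq2 e eq emp0
  obtain ⟨r4, ⟨hr1, er⟩, hr3⟩ := Int.exists_greatest_of_bdd (P := fun q => q < a + N ∧ E b q)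
    ⟨a + N, fun z hz => by omega⟩ ⟨x, x2, ex⟩
  obtain ⟨r1, ⟨hs1, es⟩, hs3⟩ := Int.exists_least_of_bdd (P := fun z => a < z ∧ E z q)
    ⟨a, fun z hz => by omega⟩ ⟨y, y1, ey⟩
  have hr4 := hr3 _ ⟨x2, ex⟩
  have hr1' := hs3 _ ⟨y1, ey⟩
  have emp2 : ∀ w, r4 < w → w < a + N → ¬ E b w := fun w w1 w2 e => by
    have := hr3 w ⟨w2, e⟩; omega
  have emp3 : ∀ w, a < w → w < r1 → ¬ E q w := fun w w1 w2 e => by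
    have := hs3 w ⟨w1, h.symm e⟩; omega
  have tm : ∀ m, r1 < m → m < b → E m r4 → False := fun m m1 m2 em =>
    h.cf hs1 m1 m2 hq1 (show q < r4 by omega) hr1 e es em
  have tu : ∀ u, q < u → u < r4 → E r1 u → False := fun u u1 u2 eu =>
    h.cf (show r1 < b by omega) hq1 u1 u2 hr1 (by omega) eu er (h.per (h.symm eq))
  have e14 : E r1 r4 := by
    obtain ⟨m, m1, m2, em⟩ := claim1 h mx (o := b) (p := r4) (q := a + N) (by omega) (by omega)
      (by omega) er (h.per (h.symm e)) emp2
    obtain ⟨u, u1, u2, eu⟩ := claim1' h mx (o := q) (p := a + N) (q := r1 + N) (by omega) (by omega)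
      (by omega) (h.per (h.symm eq)) (h.per (h.symm es))
      (fun w w1 w2 e => emp3 (w - N) (by omega) (by omega) (h.per' e))
    have em' : E (m - N) r4 := h.perL' (h.symm em)
    have eu' : E r1 u := h.cast (h.per' eu) rfl (by ring) |> h.symm |> fun e => h.cast e (by ring) rfl
    by_cases hm : m - N = r1
    · exact h.cast em' hm rfl
    by_cases hu : u = r4
    · exact h.cast eu' rfl hu
    have hm' : m - N < r1 := by
      by_contra hlt; exact tm (m - N) (by omega) (by omega) em'
    have hu' : r4 < u := by
      by_contra hlt; exact tu u (by omega) (by omega) eu'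
    exact (h.cf (show a < m - N by omega) hm' (show r1 < b by omega) (show b < r4 by omega) hu'
      u2 e em' eu').elim
  obtain ⟨r, hr, r0, _, r2, _⟩ := star_mk h hs1 (show r1 < b by omega) hq1 (show q < r4 by omega) hr1
    e es er (h.symm eq) (h.symm e14) emp0 (fun u u1 u2 eu => tu u u1 u2 eu) emp2 emp3
    (fun m m1 m2 em => tm m m1 m2 (h.symm em))
  exact ⟨r, hr, r0, r2⟩

end PartA

section PartB
variable {N : ℤ} {E : ℤ → ℤ → Prop}

theorem IsStar.perz {r : ℤ → ℤ} (hr : IsStar N E r) (i t : ℤ) : r (i + 5 * t) = r i + N * t := by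
  induction t using Int.induction_on with
  | zero => simp
  | succ k ih =>
    rw [show i + 5 * ((k : ℤ) + 1) = i + 5 * k + 5 by ring, hr.per, ih]; ring
  | pred k ih =>
    have := hr.per (i + 5 * (-(k : ℤ) - 1))
    rw [show i + 5 * (-(k : ℤ) - 1) + 5 = i + 5 * (-k) by ring, ih] at this
    linarith

theorem IsStar.reindex {r : ℤ → ℤ} (hr : IsStar N E r) (j : ℤ) : IsStar N E (fun k => r (k + j)) where
  mono := fun i => by have := hr.mono (i + j); rwa [show i + j + 1 = i + 1 + j by ring] at this
  per := fun i => by have := hr.per (i + j); rwa [show i + j + 5 = i + 5 + j by ring] at this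
  edge := fun i => by have := hr.edge (i + j); rwa [show i + j + 2 = i + 2 + j by ring] at this
  emp := fun i w => by
    have := hr.emp (i + j) w
    rwa [show i + j + 2 = i + 2 + j by ring, show i + j + 3 = i + 3 + j by ring] at this

/-- invariance of the edge relation under translation by `m` (in both directions). -/
def Inv (E : ℤ → ℤ → Prop) (m : ℤ) : Prop := ∀ a b, E (a + m) (b + m) ↔ E a b

theorem IsStar.shift {r : ℤ → ℤ} (hr : IsStar N E r) {m : ℤ} (hm : Inv E m) :
    IsStar N E (fun k => r k + m) where
  mono := fun i => by have := hr.mono i; simpa using this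
  per := fun i => by have := hr.per i; simp only [this]; ring
  edge := fun i => (hm _ _).2 (hr.edge i)
  emp := fun i w h1 h2 e => by
    refine hr.emp i (w - m) (by linarith) (by linarith) ?_
    rw [← hm]; simpa using e

theorem Sys.inv (h : Sys N E) (c : ℤ) : Inv E (N * c) := by
  have sh : ∀ (c : ℤ) {a b : ℤ}, E a b → E a (b + N * c) := by
    intro c
    induction c using Int.induction_on with
    | zero => intro a b e; simpa using e
    | succ i ih => intro a b e; exact h.cast (h.per (ih e)) rfl (by ring)
    | pred i ih => intro a b e; exact h.cast (h.per' (ih e)) rfl (by ring)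
  have sh2 : ∀ (c : ℤ) {a b : ℤ}, E a b → E (a + N * c) (b + N * c) :=
    fun c a b e => h.symm (sh c (h.symm (sh c e)))
  intro a b
  exact ⟨fun e => h.cast (sh2 (-c) e) (by ring) (by ring), sh2 c⟩

theorem Inv.add {m m' : ℤ} (h : Inv E m) (h' : Inv E m') : Inv E (m + m') := by
  intro a b
  rw [← h a b, ← h' (a + m) (b + m)]
  simp only [add_assoc]

theorem star_step {r s : ℤ → ℤ} (hr : IsStar N E r) (hs : IsStar N E s) (i : ℤ)
    (h0 : r i = s i) (h2 : r (i + 2) = s (i + 2)) : r (i + 4) = s (i + 4) := by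
  have r5 := hr.per i
  have s5 := hs.per i
  have rm := hr.mono (i + 4)
  have sm := hs.mono (i + 4)
  have re := hr.edge (i + 2)
  have se := hs.edge (i + 2)
  have rp := hr.emp (i + 2)
  have sp := hs.emp (i + 2)
  simp only [add_assoc] at rm sm re se rp sp
  norm_num at rm sm re se rp sp
  rcases lt_trichotomy (r (i + 4)) (s (i + 4)) with h | h | h
  · exact (rp _ h (by omega) (h2 ▸ se)).elim
  · exact h
  · exact (sp _ h (by omega) (h2 ▸ re)).elim

theorem star_unique {r s : ℤ → ℤ} (hr : IsStar N E r) (hs : IsStar N E s)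
    (h0 : r 0 = s 0) (h2 : r 2 = s 2) : r = s := by
  have key : ∀ k : ℕ, r (2 * k) = s (2 * k) ∧ r (2 * k + 2) = s (2 * k + 2) := by
    intro k
    induction k with
    | zero => simpa using ⟨h0, h2⟩
    | succ k ih =>
      have := star_step hr hs _ ih.1 ih.2
      push_cast
      refine ⟨?_, ?_⟩
      · rw [show (2 : ℤ) * (k + 1) = 2 * k + 2 by ring]; exact ih.2
      · rw [show (2 : ℤ) * (k + 1) + 2 = 2 * k + 4 by ring]; exact this
  funext i
  obtain ⟨k, t, hi⟩ : ∃ (k : ℕ) (t : ℤ), i = 2 * k + 5 * t :=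
    ⟨((3 * i) % 5).toNat, (i - 2 * ((3 * i) % 5)) / 5, by omega⟩
  rw [hi, hr.perz, hs.perz, (key k).1]

theorem star_unique_angle {r s : ℤ → ℤ} (hr : IsStar N E r) (hs : IsStar N E s)
    (h0 : r 0 = s 0) {w : ℤ} (r2 : r 2 < w) (r3 : w < r 3) (s2 : s 2 < w) (s3 : w < s 3) :
    r = s := by
  apply star_unique hr hs h0
  have re := hr.edge 0
  have se := hs.edge 0
  have rp := hr.emp 0
  have sp := hs.emp 0
  norm_num at re se rp sp
  rcases lt_trichotomy (r 2) (s 2) with h | h | h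
  · exact (rp _ h (by omega) (h0 ▸ se)).elim
  · exact h
  · exact (sp _ h (by omega) (h0 ▸ re)).elim

/-- no star is invariant under a rotation of order 2 or 4. -/
theorem star_no_sym {n : ℤ} (hn : 0 < n) {r : ℤ → ℤ} (hr : IsStar (4 * n) E r) {j m i c : ℤ}
    (hi : i = 1 ∨ i = 2 ∨ i = 3) (hm : m = i * n + 4 * n * c) (h : ∀ k, r (k + j) = r k + m) :
    False := by
  have h1 := h 0
  have h2 := h j
  have h3 := h (j + j)
  have h4 := h (j + j + j)
  have h5 := h (j + j + j + j)
  have h6 := hr.perz 0 j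
  rw [show (0 : ℤ) + 5 * j = j + j + j + j + j by ring] at h6
  rw [zero_add] at h1
  have : n * (5 * i + 20 * c - 4 * j) = 0 := by
    have : 5 * m = 4 * n * j := by linarith
    rw [hm] at this
    linarith
  rcases mul_eq_zero.1 this with h | h
  · omega
  · omega

theorem IsStar.facts {R : ℤ → ℤ} (h : IsStar N E R) : R 0 < R 1 ∧ R 1 < R 2 ∧ R 2 < R 3 ∧ R 3 < R 4 ∧
    R 4 < R 0 + N ∧ R 5 = R 0 + N ∧ R 6 = R 1 + N ∧ R 7 = R 2 + N := by
  have a0 := h.mono 0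
  have a1 := h.mono 1
  have a2 := h.mono 2
  have a3 := h.mono 3
  have a4 := h.mono 4
  have p0 := h.per 0
  have p1 := h.per 1
  have p2 := h.per 2
  norm_num at a0 a1 a2 a3 a4 p0 p1 p2
  refine ⟨a0, a1, a2, a3, by omega, p0, p1, p2⟩

/-- Two stars sharing the edge `(R 0, R 2)`, with the data selecting the flipped edge `(R t, S t)`. -/
structure Cfg (N : ℤ) (E : ℤ → ℤ → Prop) (R S : ℤ → ℤ) (t : ℤ) : Prop where
  hR : IsStar N E R
  hS : IsStar N E S
  h0 : S 0 = R 2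
  h2 : S 2 = R 0 + N
  ht : (t = 4 ∧ S 1 ≤ R 3 ∧ R 1 + N ≤ S 3) ∨ (t = 3 ∧ R 4 ≤ S 1 ∧ S 4 ≤ R 1 + N)

theorem cfg_exists (h : Sys N E) {R S : ℤ → ℤ} (hR : IsStar N E R) (hS : IsStar N E S)
    (h0 : S 0 = R 2) (h2 : S 2 = R 0 + N) : ∃ t, Cfg N E R S t := by
  obtain ⟨a0, a1, a2, a3, a4, a5, a6, a7⟩ := hR.facts
  obtain ⟨b0, b1, b2, b3, b4, b5, b6, b7⟩ := hS.facts
  have e02 : E (R 0) (R 2) := hR.edge 0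
  have e13 : E (R 1) (R 3) := hR.edge 1
  have e46 : E (R 4) (R 6) := hR.edge 4
  have f13 : E (S 1) (S 3) := hS.edge 1
  have f46 : E (S 4) (S 6) := hS.edge 4
  have c1 : S 1 < R 4 → R 1 + N ≤ S 3 := by
    intro hlt
    by_contra hlt2
    exact h.cf (a1 := R 2) (a2 := S 1) (a3 := R 4) (b1 := R 0 + N) (b2 := S 3) (b3 := R 1 + N)
      (by omega) (by omega) (by omega) (by omega) (by omega) (by omega)
      (h.per (h.symm e02)) f13 (a6 ▸ e46)
  have c2 : R 1 + N < S 4 → S 1 ≤ R 3 := by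
    intro hlt
    by_contra hlt2
    exact h.cf (a1 := R 0) (a2 := R 1) (a3 := S 4 - N) (b1 := R 2) (b2 := R 3) (b3 := S 1)
      (by omega) (by omega) (by omega) (by omega) (by omega) (by omega)
      e02 e13 (h.cast (h.down f46) rfl (by omega))
  by_cases hc : S 1 < R 4
  · have := c1 hc
    exact ⟨4, hR, hS, h0, h2, Or.inl ⟨rfl, c2 (by omega), this⟩⟩
  · refine ⟨3, hR, hS, h0, h2, Or.inr ⟨rfl, by omega, ?_⟩⟩
    by_contra hlt
    have := c2 (by omega)
    omega

theorem Cfg.angleR {R S : ℤ → ℤ} {t : ℤ} (c : Cfg N E R S t) : R (t + 2) < S t ∧ S t < R (t + 3) := by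
  obtain ⟨a0, a1, a2, a3, a4, a5, a6, a7⟩ := c.hR.facts
  obtain ⟨b0, b1, b2, b3, b4, b5, b6, b7⟩ := c.hS.facts
  have h0 := c.h0
  have h2 := c.h2
  rcases c.ht with ⟨ht, h⟩ | ⟨ht, h⟩ <;> subst ht <;> norm_num <;> omega

theorem Cfg.angleS {R S : ℤ → ℤ} {t : ℤ} (c : Cfg N E R S t) :
    S (t + 2) < R t + N ∧ R t + N < S (t + 3) := by
  obtain ⟨a0, a1, a2, a3, a4, a5, a6, a7⟩ := c.hR.facts
  obtain ⟨b0, b1, b2, b3, b4, b5, b6, b7⟩ := c.hS.facts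
  have h0 := c.h0
  have h2 := c.h2
  rcases c.ht with ⟨ht, h⟩ | ⟨ht, h⟩ <;> subst ht <;> norm_num <;> omega

theorem Cfg.lt {R S : ℤ → ℤ} {t : ℤ} (c : Cfg N E R S t) : R t < S t ∧ S t < R t + N := by
  obtain ⟨a0, a1, a2, a3, a4, a5, a6, a7⟩ := c.hR.facts
  obtain ⟨b0, b1, b2, b3, b4, b5, b6, b7⟩ := c.hS.facts
  have h0 := c.h0
  have h2 := c.h2
  rcases c.ht with ⟨ht, h⟩ | ⟨ht, h⟩ <;> subst ht <;> omega

theorem Cfg.nonedge {R S : ℤ → ℤ} {t : ℤ} (c : Cfg N E R S t) : ¬ E (R t) (S t) :=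
  c.hR.emp t _ c.angleR.1 c.angleR.2

theorem Cfg.core (h : Sys N E) {R S : ℤ → ℤ} {t : ℤ} (c : Cfg N E R S t) {g1 h1 g2 h2 : ℤ}
    (l1 : R t < g1) (l2 : g1 < h1) (l3 : h1 < S t) (l4 : S t < g2) (l5 : g2 < h2)
    (l6 : h2 < R t + N) (eg : E g1 g2) (eh : E h1 h2) (ng : ¬ (g1 = R 0 + N ∧ g2 = R 2 + N))
    (nh : ¬ (h1 = R 0 + N ∧ h2 = R 2 + N)) : False := by
  obtain ⟨a0, a1, a2, a3, a4, a5, a6, a7⟩ := c.hR.facts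
  obtain ⟨b0, b1, b2, b3, b4, b5, b6, b7⟩ := c.hS.facts
  have z0 := c.h0
  have z2 := c.h2
  have e02 : E (R 0) (R 2) := c.hR.edge 0
  have e13 : E (R 1) (R 3) := c.hR.edge 1
  have e24 : E (R 2) (R 4) := c.hR.edge 2
  have e35 : E (R 3) (R 5) := c.hR.edge 3
  have e46 : E (R 4) (R 6) := c.hR.edge 4
  have f13 : E (S 1) (S 3) := c.hS.edge 1
  have f24 : E (S 2) (S 4) := c.hS.edge 2
  have f35 : E (S 3) (S 5) := c.hS.edge 3
  have f46 : E (S 4) (S 6) := c.hS.edge 4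
  rcases c.ht with ⟨ht, u1, u2⟩ | ⟨ht, u1, u2⟩ <;> subst ht
  · have s1 : R 1 + N ≤ h1 := by
      by_contra hlt
      exact h.cf l1 l2 (show h1 < R 6 by omega) (by omega) l5 l6 e46 eg eh
    have s2 : g2 ≤ R 2 + N := by
      by_contra hlt
      exact h.cf l1 l2 (show h1 < R 2 + N by omega) (by omega) l5 l6 (h.per (h.symm e24)) eg eh
    have s3 : g1 ≤ R 0 + N := by
      by_contra hlt
      exact h.cf (show S 2 < g1 by omega) l2 l3 l4 l5 (by omega) f24 eg eh
    have s4 : S 1 + N ≤ h2 := by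
      by_contra hlt
      exact h.cf l2 l3 l4 l5 (show h2 < S 6 by omega) (by omega) eg eh f46
    by_cases k1 : g1 = R 0 + N
    · have k2 : g2 < R 2 + N := by
        by_contra hlt; exact ng ⟨k1, by omega⟩
      exact c.hS.emp 2 g2 l4 (by norm_num; omega) (h.cast eg (by omega) rfl)
    by_cases k2 : g2 = R 2 + N
    · refine c.hR.emp 2 g1 l1 (by norm_num; omega) (h.cast (h.perL' (h.symm eg)) (by omega) rfl)
    · exact h.cf (show g1 < R 0 + N by omega) (show R 0 + N < h1 by omega) (by omega)
        (show g2 < R 2 + N by omega) (show R 2 + N < h2 by omega) (by omega) eg (h.up e02) eh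
  · have s1 : R 0 + N ≤ h1 := by
      by_contra hlt
      exact h.cf l1 l2 (show h1 < R 5 by omega) (by omega) l5 l6 e35 eg eh
    have s2 : g2 ≤ R 1 + N := by
      by_contra hlt
      exact h.cf l1 l2 (show h1 < R 1 + N by omega) (by omega) l5 l6 (h.per (h.symm e13)) eg eh
    have s4 : R 2 + N ≤ h2 := by
      by_contra hlt
      exact h.cf l2 l3 l4 l5 (show h2 < S 5 by omega) (by omega) eg eh f35
    have s3 : g1 ≤ S 1 := by
      by_contra hlt
      exact h.cf (show S 1 < g1 by omega) l2 l3 l4 l5 (by omega) f13 eg eh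
    by_cases k1 : h1 = R 0 + N
    · have k2 : R 2 + N < h2 := by
        by_contra hlt; exact nh ⟨k1, by omega⟩
      exact c.hR.emp 0 (h2 - N) (by norm_num; omega) (by norm_num; omega)
        (h.cast (h.down eh) (by omega) rfl)
    by_cases k2 : h2 = R 2 + N
    · refine c.hS.emp 0 h1 (by norm_num; omega) (by norm_num; omega)
        (h.cast (h.perL' (h.symm eh)) (by omega) rfl)
    · exact h.cf (show g1 < R 0 + N by omega) (show R 0 + N < h1 by omega) (by omega)
        (show g2 < R 2 + N by omega) (show R 2 + N < h2 by omega) (by omega) eg (h.up e02) eh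

end PartB

section PartC
variable {N : ℤ} {E : ℤ → ℤ → Prop}

/-- A relation stable under all the symmetries of the problem. -/
structure Stab (n : ℤ) (O : ℤ → ℤ → Prop) : Prop where
  symm : ∀ {a b}, O a b → O b a
  mv : ∀ (i j : ℤ) {a b c d : ℤ}, O a b → c = a + n * i → d = b + n * i + 4 * n * j → O c d

/-- Data certifying that the orbit of `(u, v)` can replace the orbit `O`. -/
structure QData (n : ℤ) (E O : ℤ → ℤ → Prop) (u v : ℤ) : Prop where
  l1 : n < v - u
  l2 : v - u < 3 * n
  l3 : v - u ≠ 2 * n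
  ne : ¬ E u v
  q1 : ∀ {g1 h1 g2 h2 : ℤ}, u < g1 → g1 < h1 → h1 < v → v < g2 → g2 < h2 → h2 < u + 4 * n →
    E g1 g2 → E h1 h2 → ¬ O g1 g2 → ¬ O h1 h2 → False
  q2a : ∀ {k1 k2 : ℤ}, u < k1 → k1 < u + n → v < k2 → k2 < v + n → E k1 k2 → ¬ O k1 k2 → False
  q2b : ∀ {k1 k2 : ℤ}, u + n < k1 → k1 < v → v + n < k2 → k2 < u + 4 * n → E k1 k2 →
    ¬ O k1 k2 → False

theorem Sys.stab {n : ℤ} (h : Sys (4 * n) E) (hi : Inv E n) : Stab n E where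
  symm := h.symm
  mv := by
    have sh : ∀ (i : ℤ) {a b : ℤ}, E a b → E (a + n * i) (b + n * i) := by
      intro i
      induction i using Int.induction_on with
      | zero => intro a b e; simpa using e
      | succ i ih => intro a b e; exact h.cast ((hi _ _).2 (ih e)) (by ring) (by ring)
      | pred i ih =>
        intro a b e
        exact (hi _ _).1 (h.cast (ih e) (by ring) (by ring))
    have sh' : ∀ (i : ℤ) {a b : ℤ}, E a b → E a (b + 4 * n * i) := by
      intro i
      induction i using Int.induction_on with
      | zero => intro a b e; simpa using e
      | succ i ih => intro a b e; exact h.cast (h.per (ih e)) rfl (by ring)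
      | pred i ih => intro a b e; exact h.cast (h.per' (ih e)) rfl (by ring)
    intro i j a b c d e h1 h2
    subst h1 h2
    exact sh' j (sh i e)

theorem qcore_lt {n : ℤ} {O : ℤ → ℤ → Prop} (h : Sys (4 * n) E) (hi : Inv E n)
    {R : ℤ → ℤ} (hR : IsStar (4 * n) E R) (r1 : R 2 = R 1 + n) (r3 : R 3 = R 0 + 3 * n)
    (hx : R 1 < R 0 + n) (hOe : O (R 1) (R 3)) : QData n E O (R 0) (R 4 - n) := by
  obtain ⟨a0, a1, a2, a3, a4, a5, a6, a7⟩ := hR.facts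
  have hE := h.stab hi
  have e02 : E (R 0) (R 2) := hR.edge 0
  have e13 : E (R 1) (R 3) := hR.edge 1
  have e24 : E (R 2) (R 4) := hR.edge 2
  have e35 : E (R 3) (R 5) := hR.edge 3
  have e46 : E (R 4) (R 6) := hR.edge 4
  have p0 := hR.emp 0
  have p1 := hR.emp 1
  have p2 := hR.emp 2
  have p3 := hR.emp 3
  have p4 := hR.emp 4
  norm_num at p0 p1 p2 p3 p4
  have p5 : ∀ w, R 7 < w → w < R 8 → ¬ E (R 5) w := by have := hR.emp 5; norm_num at this; exact this
  have a8 : R 8 = R 3 + 4 * n := hR.per 3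
  obtain ⟨x, hxx⟩ : ∃ x, x = R 1 - R 0 := ⟨_, rfl⟩
  obtain ⟨y, hyy⟩ : ∃ y, y = R 4 - R 3 := ⟨_, rfl⟩
  obtain ⟨o, ho⟩ : ∃ o, o = R 0 := ⟨_, rfl⟩
  rw [show R 1 = o + x by omega, show R 3 = o + 3 * n by omega] at hOe
  rw [show R 0 = o by omega, show R 2 = o + x + n by omega] at e02
  rw [show R 1 = o + x by omega, show R 3 = o + 3 * n by omega] at e13
  rw [show R 2 = o + x + n by omega, show R 4 = o + y + 3 * n by omega] at e24
  rw [show R 3 = o + 3 * n by omega, show R 5 = o + 4 * n by omega] at e35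
  rw [show R 4 = o + y + 3 * n by omega, show R 6 = o + x + 4 * n by omega] at e46
  rw [show R 0 = o by omega, show R 2 = o + x + n by omega, show R 3 = o + 3 * n by omega] at p0
  rw [show R 1 = o + x by omega, show R 3 = o + 3 * n by omega, show R 4 = o + y + 3 * n by omega] at p1
  rw [show R 2 = o + x + n by omega, show R 4 = o + y + 3 * n by omega, show R 5 = o + 4 * n by omega] at p2
  rw [show R 3 = o + 3 * n by omega, show R 5 = o + 4 * n by omega, show R 6 = o + x + 4 * n by omega] at p3
  rw [show R 4 = o + y + 3 * n by omega, show R 6 = o + x + 4 * n by omega, show R 7 = o + x + 5 * n by omega] at p4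
  rw [show R 0 = o by omega, show R 4 - n = o + y + 2 * n by omega]
  have x0 : 0 < x := by omega
  have xn : x < n := by omega
  have y0 : 0 < y := by omega
  have yn : y < n := by omega
  clear a0 a1 a2 a3 a4 a5 a6 a7 a8 p5 r1 r3 hx
  clear ho hxx hyy
  -- x ≤ y
  have xy : x ≤ y := by
    by_contra hlt
    exact h.cf (a1 := o - n) (a2 := o) (a3 := o + y) (b1 := o + x) (b2 := o + n) (b3 := o + x + n)
      (by omega) (by omega) (by omega) (by omega) (by omega) (by omega)
      (hE.mv (-1) 0 e02 (by omega) (by omega)) (hE.mv (-3) 0 e35 (by omega) (by omega))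
      (hE.mv (-3) 0 e46 (by omega) (by omega))
  refine ⟨by omega, by omega, ?_, ?_, ?_, ?_, ?_⟩
  · omega
  · exact p0 _ (by omega) (by omega)
  · intro g1 h1 g2 h2 l1 l2 l3 l4 l5 l6 eg eh ng nh
    have s1 : o + n ≤ h1 := by
      by_contra hlt
      exact h.cf l1 l2 (show h1 < o + n by omega) (by omega) l5 l6
        (hE.mv (-3) 0 e35 (by omega) (by omega)) eg eh
    have s2 : g2 ≤ o + 3 * n := by
      by_contra hlt
      exact h.cf l1 l2 (show h1 < o + 3 * n by omega) (by omega) l5 l6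
        (hE.mv (-4) 1 (hE.symm e35) (by omega) (by omega)) eg eh
    have s3 : o + x + 3 * n ≤ h2 := by
      by_contra hlt
      exact h.cf l2 l3 l4 l5 (show h2 < o + x + 3 * n by omega) (by omega) eg eh
        (hE.mv (-1) 0 e46 (by omega) (by omega))
    have s4 : g1 ≤ o + x := by
      by_contra hlt
      exact h.cf (show o + x < g1 by omega) l2 l3 l4 l5 (by omega)
        (hE.mv (-1) 0 e24 (by omega) (by omega)) eg eh
    by_cases k1 : g1 = o + x
    · by_cases k2 : g2 = o + 3 * n
      · exact ng (k1 ▸ k2 ▸ hOe)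
      · exact p2 (g2 + n) (by omega) (by omega) (hE.mv 1 0 eg (by omega) (by omega))
    by_cases k2 : g2 = o + 3 * n
    · exact p3 (g1 + 4 * n) (by omega) (by omega) (hE.mv 0 1 (hE.symm eg) (by omega) (by omega))
    · exact h.cf (show g1 < o + x by omega) (show o + x < h1 by omega) (by omega)
        (show g2 < o + 3 * n by omega) (show o + 3 * n < h2 by omega) (by omega) eg e13 eh
  · intro k1 k2 l1 l2 l3 l4 ek nk
    by_cases c1 : k1 = o + x
    · by_cases c2 : k2 = o + 3 * n
      · exact nk (c1 ▸ c2 ▸ hOe)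
      by_cases c3 : k2 < o + 3 * n
      · exact p2 (k2 + n) (by omega) (by omega) (hE.mv 1 0 ek (by omega) (by omega))
      · exact p1 k2 (by omega) (by omega) (hE.mv 0 0 ek (by omega) (by omega))
    by_cases c2 : k2 = o + 3 * n
    · by_cases c3 : k1 < o + x
      · exact p3 (k1 + 4 * n) (by omega) (by omega) (hE.mv 0 1 (hE.symm ek) (by omega) (by omega))
      · exact p0 (k1 + n) (by omega) (by omega) (hE.mv (-3) 1 (hE.symm ek) (by omega) (by omega))
    by_cases c3 : k1 < o + x
    · by_cases c4 : k2 < o + 3 * n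
      · exact h.cf l1 c3 (show o + x < o + x + n by omega) (by omega) c4 (by omega) e02 ek e13
      · exact h.cf (a1 := k2 - 4 * n) (a2 := o + y - n) (a3 := o) (b1 := k1) (b2 := o + x)
          (b3 := o + n) (by omega) (by omega) (by omega) (by omega) (by omega) (by omega)
          (hE.mv (-4) 1 (hE.symm ek) (by omega) (by omega))
          (hE.mv (-4) 0 e46 (by omega) (by omega)) (hE.mv (-3) 0 e35 (by omega) (by omega))
    · by_cases c4 : k2 < o + 3 * n
      · exact h.cf (a1 := o) (a2 := o + x) (a3 := k1) (b1 := o + x + n) (b2 := o + y + 2 * n)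
          (b3 := k2) (by omega) (by omega) (by omega) (by omega) (by omega) (by omega)
          e02 (hE.mv (-1) 0 e24 (by omega) (by omega)) ek
      · exact h.cf (a1 := o) (a2 := o + x) (a3 := k1) (b1 := o + x + n) (b2 := o + 3 * n)
          (b3 := k2) (by omega) (by omega) (by omega) (by omega) (by omega) (by omega)
          e02 e13 ek
  · intro k1 k2 l1 l2 l3 l4 ek nk
    by_cases c1 : k1 = o + x + n
    · exact p2 k2 (by omega) (by omega) (c1 ▸ ek)
    by_cases c2 : k1 < o + x + n
    · exact h.cf (a1 := o + n) (a2 := k1) (a3 := o + x + n) (b1 := o + x + 2 * n) (b2 := k2)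
          (b3 := o + 4 * n) (by omega) (by omega) (by omega) (by omega) (by omega) (by omega)
          (hE.mv 1 0 e02 (by omega) (by omega)) ek (hE.mv 1 0 e13 (by omega) (by omega))
    by_cases c3 : k1 < o + x + 2 * n
    · exact h.cf (a1 := o + n) (a2 := o + x + n) (a3 := k1) (b1 := o + x + 2 * n)
          (b2 := o + y + 3 * n)
          (b3 := k2) (by omega) (by omega) (by omega) (by omega) (by omega) (by omega)
          (hE.mv 1 0 e02 (by omega) (by omega)) e24 ek
    · exact h.cf (a1 := o + x) (a2 := o + 2 * n) (a3 := k1) (b1 := o + y + 2 * n)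
          (b2 := o + x + 3 * n)
          (b3 := k2) (by omega) (by omega) (by omega) (by omega) (by omega) (by omega)
          (hE.mv (-1) 0 e24 (by omega) (by omega)) (hE.mv 2 0 e02 (by omega) (by omega)) ek

theorem IsStar.refl_neg (h : Sys N E) {R : ℤ → ℤ} (hR : IsStar N E R) (j : ℤ) :
    IsStar N (fun a b => E (-a) (-b)) (fun k => - R (j - k)) where
  mono := fun i => by
    have := hR.mono (j - (i + 1))
    rw [show j - (i + 1) + 1 = j - i by ring] at this
    linarith
  per := fun i => by
    have := hR.per (j - (i + 5))
    rw [show j - (i + 5) + 5 = j - i by ring] at this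
    linarith
  edge := fun i => by
    have := hR.edge (j - (i + 2))
    rw [show j - (i + 2) + 2 = j - i by ring] at this
    simpa using h.symm this
  emp := fun i w h1 h2 e => by
    simp only [neg_neg] at e
    have p2 := hR.per (j - (i + 2))
    have p3 := hR.per (j - (i + 3))
    rw [show j - (i + 2) + 5 = j - i + 3 by ring] at p2
    rw [show j - (i + 3) + 5 = j - i + 2 by ring] at p3
    exact hR.emp (j - i) (-w + N) (by linarith) (by linarith) (h.per e)

theorem QData.mirror {n : ℤ} {O : ℤ → ℤ → Prop} (h : Sys (4 * n) E) (hi : Inv E n) (hO : Stab n O)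
    {u v : ℤ} (q : QData n (fun a b => E (-a) (-b)) (fun a b => O (-a) (-b)) u v) :
    QData n E O (-v) (-u) := by
  have hE := h.stab hi
  have := q.l1
  have := q.l2
  have := q.l3
  refine ⟨by omega, by omega, by omega, fun e => q.ne (h.symm e), ?_, ?_, ?_⟩
  · intro g1 h1 g2 h2 l1 l2 l3 l4 l5 l6 eg eh ng nh
    exact q.q1 (g1 := -h1) (h1 := -g1) (g2 := -h2 + 4 * n) (h2 := -g2 + 4 * n)
      (by omega) (by omega) (by omega) (by omega) (by omega) (by omega)
      (hE.mv 0 (-1) eh (by omega) (by omega)) (hE.mv 0 (-1) eg (by omega) (by omega))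
      (fun o => nh (hO.mv 0 1 o (by omega) (by omega)))
      (fun o => ng (hO.mv 0 1 o (by omega) (by omega)))
  · intro k1 k2 l1 l2 l3 l4 ek nk
    exact q.q2a (k1 := -k2 + n) (k2 := -k1 + n) (by omega) (by omega) (by omega) (by omega)
      (hE.mv (-1) 0 (hE.symm ek) (by omega) (by omega))
      (fun o => nk (hO.symm (hO.mv 1 0 o (by omega) (by omega))))
  · intro k1 k2 l1 l2 l3 l4 ek nk
    exact q.q2b (k1 := -k1 + n) (k2 := -k2 + 5 * n) (by omega) (by omega) (by omega) (by omega)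
      (hE.mv (-1) (-1) ek (by omega) (by omega))
      (fun o => nk (hO.mv 1 1 o (by omega) (by omega)))

/-- Existence of the replacing orbit in the case where the two stars at `e` are in the same
orbit under the rotation by `n`. -/
theorem qcore {n : ℤ} {O : ℤ → ℤ → Prop} (h : Sys (4 * n) E) (hi : Inv E n) (hO : Stab n O)
    {R : ℤ → ℤ} (hR : IsStar (4 * n) E R) (r1 : R 2 = R 1 + n) (r3 : R 3 = R 0 + 3 * n)
    (hx : R 1 ≠ R 0 + n) (hOe : O (R 1) (R 3)) : ∃ u v, QData n E O u v := by
  obtain ⟨a0, a1, a2, a3, a4, a5, a6, a7⟩ := hR.facts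
  rcases lt_or_gt_of_ne hx with hx | hx
  · exact ⟨_, _, qcore_lt h hi hR r1 r3 hx hOe⟩
  · have hi' : Inv (fun a b => E (-a) (-b)) n := by
      intro a b
      have := hi (-(a + n)) (-(b + n))
      simpa using this.symm
    have q := qcore_lt (O := fun a b => O (-a) (-b)) h.refl_neg hi' (hR.refl_neg h 3) (by norm_num; omega)
      (by norm_num; omega) (by norm_num; omega)
      (by
        norm_num
        exact hO.mv 1 (-1) hOe (by omega) (by omega))
    exact ⟨_, _, q.mirror h hi hO⟩

end PartC

section PartD
/-- The lift of an edge set of the `m`-gon to the integers. -/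
def ET {m : ℕ} (T : Set (Sym2 (ZMod m))) (a b : ℤ) : Prop := s((a : ZMod m), (b : ZMod m)) ∈ T

theorem cast_eq_iff {m : ℕ} {a b : ℤ} : ((a : ZMod m) = (b : ZMod m)) ↔ ∃ k : ℤ, b = a + k * m := by
  rw [ZMod.intCast_eq_intCast_iff_dvd_sub]
  constructor
  · rintro ⟨k, hk⟩; exact ⟨k, by linarith⟩
  · rintro ⟨k, hk⟩; exact ⟨k, by rw [hk]; ring⟩

theorem mul_lt_one {m k : ℤ} (hm : 0 < m) (h : k * m < m) : k ≤ 0 := by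
  by_contra hk
  have : 1 * m ≤ k * m := mul_le_mul_of_nonneg_right (by omega) hm.le
  linarith

theorem edge_eq {m : ℕ} (hm : 0 < m) {a b a1 b1 : ℤ} (h1 : a < b) (h2 : b < a + m)
    (h3 : a1 < b1) (h4 : b1 < a1 + m)
    (h : s((a1 : ZMod m), (b1 : ZMod m)) = s((a : ZMod m), (b : ZMod m))) :
    ∃ k : ℤ, (a1 = a + k * m ∧ b1 = b + k * m) ∨ (a1 = b + k * m ∧ b1 = a + m + k * m) := by
  have hm' : (0 : ℤ) < m := by exact_mod_cast hm
  rw [Sym2.eq_iff] at h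
  rcases h with ⟨ha, hb⟩ | ⟨ha, hb⟩
  · obtain ⟨k, hk⟩ := cast_eq_iff.1 ha.symm
    obtain ⟨l, hl⟩ := cast_eq_iff.1 hb.symm
    refine ⟨k, Or.inl ⟨hk, ?_⟩⟩
    have e1 : (k - l) * m < m := by linarith
    have e2 : (l - k) * m < m := by linarith
    have := mul_lt_one hm' e1
    have := mul_lt_one hm' e2
    have : k = l := by omega
    rw [this]; exact hl
  · obtain ⟨k, hk⟩ := cast_eq_iff.1 ha.symm
    obtain ⟨l, hl⟩ := cast_eq_iff.1 hb.symm
    refine ⟨k, Or.inr ⟨hk, ?_⟩⟩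
    have e1 : (k + 1 - l) * m < m := by linarith
    have e2 : (l - 1 - k) * m < m := by linarith
    have := mul_lt_one hm' e1
    have := mul_lt_one hm' e2
    have : l = k + 1 := by omega
    rw [hl, this]; ring

theorem rep_uniq {m : ℕ} {a b c d : ℤ} (h0 : 0 ≤ a) (h1 : a < b) (h2 : b < m)
    (h3 : 0 ≤ c) (h4 : c < d) (h5 : d < m)
    (h : s((a : ZMod m), (b : ZMod m)) = s((c : ZMod m), (d : ZMod m))) : a = c ∧ b = d := by
  have hm : 0 < m := by omega
  have hm' : (0 : ℤ) < m := by omega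
  obtain ⟨k, h | h⟩ := edge_eq hm h4 (by omega) h1 (by omega) h
  · have e1 : k * m < m := by linarith
    have e2 : (-k) * m < m := by linarith
    have := mul_lt_one hm' e1
    have := mul_lt_one hm' e2
    have : k = 0 := by omega
    subst this; simpa using h
  · exfalso
    have e1 : (k + 1) * m < m := by linarith
    have := mul_lt_one hm' e1
    have e2 : (-k) * m < m := by linarith
    have := mul_lt_one hm' e2
    omega

theorem ne_of_inter {m : ℕ} {u v g1 g2 : ℤ} (l1 : u < g1) (l2 : g1 < v) (l3 : v < g2)
    (l4 : g2 < u + m) : s((g1 : ZMod m), (g2 : ZMod m)) ≠ s((u : ZMod m), (v : ZMod m)) := by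
  intro h
  have hm : 0 < m := by omega
  have hm' : (0 : ℤ) < m := by omega
  obtain ⟨k, h | h⟩ := edge_eq hm (by omega) (by omega) (by omega) (by omega) h
  · have e1 : (k - 0) * m < m := by linarith
    have := mul_lt_one hm' e1
    rcases eq_or_lt_of_le this with h' | h'
    · have : k = 0 := by omega
      subst this; omega
    · have : k * m < 0 := mul_neg_of_neg_of_pos (by omega) hm'
      omega
  · have e1 : (k + 1) * m < m := by linarith
    have := mul_lt_one hm' e1
    have e2 : (-k) * m < m := by linarith
    have := mul_lt_one hm' e2
    omega

theorem nd_rep {m : ℕ} [NeZero m] {x y : ZMod m} (h : x.val < y.val) :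
    0 ≤ (x.val : ℤ) ∧ (x.val : ℤ) < y.val ∧ (y.val : ℤ) < m ∧
    s(x, y) = s(((x.val : ℤ) : ZMod m), ((y.val : ℤ) : ZMod m)) := by
  refine ⟨by omega, by omega, ?_, by simp⟩
  exact_mod_cast ZMod.val_lt y

theorem exists_rep {m : ℕ} [NeZero m] {e : Sym2 (ZMod m)} (h : ¬ e.IsDiag) :
    ∃ a b : ℤ, 0 ≤ a ∧ a < b ∧ b < m ∧ e = s((a : ZMod m), (b : ZMod m)) := by
  induction e using Sym2.ind with
  | _ x y =>
    have hxy : x ≠ y := by simpa using h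
    rcases lt_trichotomy x.val y.val with h | h | h
    · exact ⟨_, _, nd_rep h⟩
    · exact (hxy (ZMod.val_injective m h)).elim
    · rw [Sym2.eq_swap]; exact ⟨_, _, nd_rep h⟩

theorem pc_elim {m : ℕ} [NeZero m] {e f : Sym2 (ZMod m)} (h : PolyCrosses e f) :
    ∃ a b c d : ℤ, 0 ≤ a ∧ a < b ∧ b < m ∧ 0 ≤ c ∧ c < d ∧ d < m ∧
      e = s((a : ZMod m), (b : ZMod m)) ∧ f = s((c : ZMod m), (d : ZMod m)) ∧
      ((a < c ∧ c < b ∧ b < d) ∨ (c < a ∧ a < d ∧ d < b)) := by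
  obtain ⟨x, y, z, w, rfl, rfl, h⟩ := h
  unfold crossIndex at h
  rcases lt_trichotomy x.val y.val with h1 | h1 | h1
  · rcases lt_trichotomy z.val w.val with h2 | h2 | h2
    · obtain ⟨p1, p2, p3, p4⟩ := nd_rep h1
      obtain ⟨q1, q2, q3, q4⟩ := nd_rep h2
      exact ⟨_, _, _, _, p1, p2, p3, q1, q2, q3, p4, q4, by omega⟩
    · omega
    · obtain ⟨p1, p2, p3, p4⟩ := nd_rep h1
      obtain ⟨q1, q2, q3, q4⟩ := nd_rep h2
      exact ⟨_, _, _, _, p1, p2, p3, q1, q2, q3, p4, Sym2.eq_swap.trans q4, by omega⟩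
  · omega
  · rcases lt_trichotomy z.val w.val with h2 | h2 | h2
    · obtain ⟨p1, p2, p3, p4⟩ := nd_rep h1
      obtain ⟨q1, q2, q3, q4⟩ := nd_rep h2
      exact ⟨_, _, _, _, p1, p2, p3, q1, q2, q3, Sym2.eq_swap.trans p4, q4, by omega⟩
    · omega
    · obtain ⟨p1, p2, p3, p4⟩ := nd_rep h1
      obtain ⟨q1, q2, q3, q4⟩ := nd_rep h2
      exact ⟨_, _, _, _, p1, p2, p3, q1, q2, q3, Sym2.eq_swap.trans p4, Sym2.eq_swap.trans q4,
        by omega⟩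

theorem pc_elim' {m : ℕ} [NeZero m] {a b c d : ℤ} (h0 : 0 ≤ a) (h1 : a < b) (h2 : b < m)
    (h3 : 0 ≤ c) (h4 : c < d) (h5 : d < m)
    (h : PolyCrosses s((a : ZMod m), (b : ZMod m)) s((c : ZMod m), (d : ZMod m))) :
    ((a < c ∧ c < b ∧ b < d) ∨ (c < a ∧ a < d ∧ d < b)) := by
  obtain ⟨a', b', c', d', p1, p2, p3, q1, q2, q3, e1, e2, h⟩ := pc_elim h
  obtain ⟨rfl, rfl⟩ := rep_uniq h0 h1 h2 p1 p2 p3 e1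
  obtain ⟨rfl, rfl⟩ := rep_uniq h3 h4 h5 q1 q2 q3 e2
  exact h

theorem pc_ne {m : ℕ} [NeZero m] {e f : Sym2 (ZMod m)} (h : PolyCrosses e f) : e ≠ f := by
  obtain ⟨a, b, c, d, p1, p2, p3, q1, q2, q3, rfl, rfl, h⟩ := pc_elim h
  intro he
  obtain ⟨rfl, rfl⟩ := rep_uniq p1 p2 p3 q1 q2 q3 he
  omega

theorem pc_symm {m : ℕ} {e f : Sym2 (ZMod m)} (h : PolyCrosses e f) : PolyCrosses f e := by
  obtain ⟨x, y, z, w, h1, h2, h⟩ := h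
  exact ⟨z, w, x, y, h2, h1, h.symm⟩

theorem emod_cases {m a x : ℤ} (hm : 0 < m) (h1 : a ≤ x) (h2 : x < a + m) :
    x % m = a % m + (x - a) ∨ x % m = a % m + (x - a) - m := by
  have := Int.emod_nonneg a hm.ne'
  have := Int.emod_lt_of_pos a hm
  have e : x % m = (a % m + (x - a)) % m := by
    rw [Int.emod_add_emod]; congr 1; ring
  by_cases h : a % m + (x - a) < m
  · left; rw [e]; exact Int.emod_eq_of_lt (by omega) h
  · right; rw [e, ← Int.sub_emod_right]; exact Int.emod_eq_of_lt (by omega) (by omega)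

theorem pc_intro {m : ℕ} {a b c d : ℤ} (h1 : a < c) (h2 : c < b) (h3 : b < d) (h4 : d < a + m) :
    PolyCrosses s((a : ZMod m), (b : ZMod m)) s((c : ZMod m), (d : ZMod m)) := by
  have hm : (0 : ℤ) < m := by omega
  haveI : NeZero m := ⟨by omega⟩
  refine ⟨_, _, _, _, rfl, rfl, ?_⟩
  have va := ZMod.val_intCast (n := m) a
  have vb := ZMod.val_intCast (n := m) b
  have vc := ZMod.val_intCast (n := m) c
  have vd := ZMod.val_intCast (n := m) d
  have eb := emod_cases hm (show a ≤ b by omega) (by omega)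
  have ec := emod_cases hm (show a ≤ c by omega) (by omega)
  have ed := emod_cases hm (show a ≤ d by omega) (by omega)
  have r1 := Int.emod_nonneg a hm.ne'
  have r2 := Int.emod_lt_of_pos a hm
  have r3 := Int.emod_nonneg b hm.ne'
  have r4 := Int.emod_lt_of_pos b hm
  have r5 := Int.emod_nonneg c hm.ne'
  have r6 := Int.emod_lt_of_pos c hm
  have r7 := Int.emod_nonneg d hm.ne'
  have r8 := Int.emod_lt_of_pos d hm
  rw [← va] at eb ec ed r1 r2
  rw [← vb] at eb r3 r4
  rw [← vc] at ec r5 r6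
  rw [← vd] at ed r7 r8
  clear va vb vc vd
  unfold crossIndex
  omega

theorem sys_of_cf {m : ℕ} (hm : 5 ≤ m) {T : Set (Sym2 (ZMod m))} (h : PolyCrossingFree 3 T) :
    Sys m (ET T) where
  hN := by exact_mod_cast hm
  symm := fun e => by unfold ET at *; rwa [Sym2.eq_swap]
  per := fun e => by unfold ET at *; simpa using e
  per' := fun e => by unfold ET at *; simpa using e
  cf := by
    intro a1 a2 a3 b1 b2 b3 l1 l2 l3 l4 l5 l6 e1 e2 e3
    haveI : NeZero m := ⟨by omega⟩
    apply h
    have c12 := pc_intro (m := m) l1 (by omega : a2 < b1) l4 (by omega)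
    have c13 := pc_intro (m := m) (by omega : a1 < a3) (by omega : a3 < b1) (by omega : b1 < b3) (by omega)
    have c23 := pc_intro (m := m) l2 (by omega : a3 < b2) l5 (by omega)
    refine ⟨{s((a1 : ZMod m), (b1 : ZMod m)), s((a2 : ZMod m), (b2 : ZMod m)),
      s((a3 : ZMod m), (b3 : ZMod m))}, ?_, ?_, ?_⟩
    · intro e he
      simp only [Finset.coe_insert, Finset.coe_singleton, Set.mem_insert_iff,
        Set.mem_singleton_iff] at he
      rcases he with rfl | rfl | rfl
      · exact e1
      · exact e2
      · exact e3
    · rw [Finset.card_eq_three]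
      exact ⟨_, _, _, pc_ne c12, pc_ne c13, pc_ne c23, rfl⟩
    · intro e he f hf hne
      simp only [Finset.mem_insert, Finset.mem_singleton] at he hf
      rcases he with rfl | rfl | rfl <;> rcases hf with rfl | rfl | rfl <;>
        first | exact (hne rfl).elim | assumption | (apply pc_symm; assumption)

theorem cf_of_sys {m : ℕ} {T : Set (Sym2 (ZMod m))} (hv : PolyValid T)
    (h : Sys m (ET T)) : PolyCrossingFree 3 T := by
  rintro ⟨S, hS, hc, hx⟩
  haveI : NeZero m := ⟨by have := h.hN; omega⟩
  obtain ⟨x, y, z, hxy, hxz, hyz, rfl⟩ := Finset.card_eq_three.1 hc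
  have mx : x ∈ T := hS (by simp)
  have my : y ∈ T := hS (by simp)
  have mz : z ∈ T := hS (by simp)
  have c12 := hx x (by simp) y (by simp) hxy
  have c13 := hx x (by simp) z (by simp) hxz
  have c23 := hx y (by simp) z (by simp) hyz
  obtain ⟨a1, b1, p1, q1, r1, rfl⟩ := exists_rep (hv x mx)
  obtain ⟨a2, b2, p2, q2, r2, rfl⟩ := exists_rep (hv y my)
  obtain ⟨a3, b3, p3, q3, r3, rfl⟩ := exists_rep (hv z mz)
  have d12 := pc_elim' p1 q1 r1 p2 q2 r2 c12
  have d13 := pc_elim' p1 q1 r1 p3 q3 r3 c13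
  have d23 := pc_elim' p2 q2 r2 p3 q3 r3 c23
  have t12 : a1 < a2 ∨ a2 < a1 := by omega
  have t13 : a1 < a3 ∨ a3 < a1 := by omega
  have t23 : a2 < a3 ∨ a3 < a2 := by omega
  have F : ∀ {a1 a2 a3 b1 b2 b3 : ℤ}, a1 < a2 → a2 < a3 → (a3 < b1 ∧ b1 < b2 ∧ b2 < b3 ∧
    b3 < a1 + m) → ET T a1 b1 → ET T a2 b2 → ET T a3 b3 → False :=
    fun h1 h2 ⟨h3, h4, h5, h6⟩ e1 e2 e3 => h.cf h1 h2 h3 h4 h5 h6 e1 e2 e3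
  rcases t12 with t12 | t12 <;> rcases t13 with t13 | t13 <;> rcases t23 with t23 | t23
  · exact F t12 t23 (by omega) mx my mz
  · exact F t13 t23 (by omega) mx mz my
  · omega
  · exact F t13 t12 (by omega) mz mx my
  · exact F t12 t13 (by omega) my mx mz
  · omega
  · exact F t23 t13 (by omega) my mz mx
  · exact F t23 t12 (by omega) mz my mx

/-- Insertion of a set of edges none of which is blocked. -/
theorem sys_insert {m : ℕ} {X F : Set (Sym2 (ZMod m))} (h : Sys m (ET X))
    (hF : ∀ f ∈ F, ∃ u v : ℤ, u < v ∧ v < u + m ∧ f = s((u : ZMod m), (v : ZMod m)) ∧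
      ∀ g1 h1 g2 h2 : ℤ, u < g1 → g1 < h1 → h1 < v → v < g2 → g2 < h2 → h2 < u + m →
        ET (X ∪ F) g1 g2 → ET (X ∪ F) h1 h2 → False) : Sys m (ET (X ∪ F)) where
  hN := h.hN
  symm := fun e => by unfold ET at *; rwa [Sym2.eq_swap]
  per := fun e => by unfold ET at *; simpa using e
  per' := fun e => by unfold ET at *; simpa using e
  cf := by
    have hm : 0 < m := by have := h.hN; omega
    have key : ∀ {a1 a2 a3 b1 b2 b3 : ℤ}, a1 < a2 → a2 < a3 → a3 < b1 → b1 < b2 → b2 < b3 →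
        b3 < a1 + m → s((a1 : ZMod m), (b1 : ZMod m)) ∈ F → ET (X ∪ F) a2 b2 →
        ET (X ∪ F) a3 b3 → False := by
      intro a1 a2 a3 b1 b2 b3 l1 l2 l3 l4 l5 l6 e1 e2 e3
      obtain ⟨u, v, huv, hvu, heq, hb⟩ := hF _ e1
      have cz : ∀ (a b k l : ℤ), ET (X ∪ F) a b → ET (X ∪ F) (a - k * m) (b - l * m) := by
        intro a b k l e; unfold ET at *; simpa using e
      obtain ⟨k, ⟨h1, h2⟩ | ⟨h1, h2⟩⟩ := edge_eq hm huv hvu (by omega) (by omega) heq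
      · exact hb (a2 - k * m) (a3 - k * m) (b2 - k * m) (b3 - k * m) (by linarith) (by linarith)
          (by linarith) (by linarith) (by linarith) (by linarith) (cz _ _ _ _ e2) (cz _ _ _ _ e3)
      · refine hb (b2 - (k + 1) * m) (b3 - (k + 1) * m) (a2 - k * m) (a3 - k * m) (by linarith)
          (by linarith) (by linarith) (by linarith) (by linarith) (by linarith) ?_ ?_
        · have := cz _ _ k (k + 1) e2; unfold ET at *; rwa [Sym2.eq_swap]
        · have := cz _ _ k (k + 1) e3; unfold ET at *; rwa [Sym2.eq_swap]
    have rot : ∀ {a b : ℤ}, ET (X ∪ F) a b → ET (X ∪ F) b (a + m) := by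
      intro a b e; unfold ET at *; rw [Sym2.eq_swap]; simpa using e
    have rotF : ∀ {a b : ℤ}, s((a : ZMod m), (b : ZMod m)) ∈ F →
      s((b : ZMod m), ((a + m : ℤ) : ZMod m)) ∈ F := by
      intro a b e; rw [Sym2.eq_swap]; simpa using e
    intro a1 a2 a3 b1 b2 b3 l1 l2 l3 l4 l5 l6 e1 e2 e3
    rcases e1 with f1 | f1
    · rcases e2 with f2 | f2
      · rcases e3 with f3 | f3
        · exact h.cf l1 l2 l3 l4 l5 l6 f1 f2 f3
        · exact key (a1 := a3) (a2 := b1) (a3 := b2) (b1 := b3) (b2 := a1 + m) (b3 := a2 + m)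
            l3 l4 l5 l6 (by omega) (by omega) f3 (rot (Or.inl f1)) (rot (Or.inl f2))
      · exact key (a1 := a2) (a2 := a3) (a3 := b1) (b1 := b2) (b2 := b3) (b3 := a1 + m)
            l2 l3 l4 l5 l6 (by omega) f2 e3 (rot (Or.inl f1))
    · exact key l1 l2 l3 l4 l5 l6 f1 e2 e3

theorem diag_ne {m : ℕ} {a b : ℤ} (h1 : a < b) (h2 : b < a + m) :
    ¬ (s((a : ZMod m), (b : ZMod m))).IsDiag := by
  rw [Sym2.mk_isDiag_iff, cast_eq_iff]
  rintro ⟨k, hk⟩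
  have hm : (0 : ℤ) < m := by omega
  have e1 : k * m < m := by linarith
  have := mul_lt_one hm e1
  have := mul_nonpos_of_nonpos_of_nonneg this hm.le
  omega

theorem mx_of {m : ℕ} (hm : 5 ≤ m) {T : Set (Sym2 (ZMod m))} (hT : IsPolyTriangulation T) :
    Mx m (ET T) := by
  intro a b hab hba he
  by_contra hno
  push Not at hno
  have h := sys_of_cf hm hT.2.1
  have h2 : Sys m (ET (T ∪ {s((a : ZMod m), (b : ZMod m))})) := by
    refine sys_insert h ?_
    rintro f rfl
    refine ⟨a, b, hab, hba, rfl, ?_⟩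
    intro g1 h1 g2 h2 l1 l2 l3 l4 l5 l6 eg eh
    have eg' : ET T g1 g2 := by
      rcases eg with eg | eg
      · exact eg
      · exact (ne_of_inter l1 (by omega) l4 (by omega) eg).elim
    have eh' : ET T h1 h2 := by
      rcases eh with eh | eh
      · exact eh
      · exact (ne_of_inter (by omega) l3 (by omega) l6 eh).elim
    exact hno g1 h1 g2 h2 l1 l2 l3 l4 l5 l6 eg' eh'
  have hv : PolyValid (T ∪ {s((a : ZMod m), (b : ZMod m))}) := by
    rintro f (hf | rfl)
    · exact hT.1 f hf
    · exact diag_ne hab hba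
  have := hT.2.2 _ hv (cf_of_sys hv h2) Set.subset_union_left
  apply he
  unfold ET
  rw [← this]
  exact Or.inr rfl

end PartD

section PartE
section count
open Classical in
/-- ordered pairs (darts) of the edge set. -/
noncomputable def darts {m : ℕ} [NeZero m] (T : Set (Sym2 (ZMod m))) : Finset (ZMod m × ZMod m) :=
  Finset.univ.filter (fun p => s(p.1, p.2) ∈ T)

/-- length of a dart. -/
def dl {m : ℕ} (p : ZMod m × ZMod m) : ℤ := ((p.2 - p.1).val : ℤ)

theorem mem_darts {m : ℕ} [NeZero m] {T : Set (Sym2 (ZMod m))} {p : ZMod m × ZMod m} :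
    p ∈ darts T ↔ s(p.1, p.2) ∈ T := by simp [darts]

theorem dl_cast {m : ℕ} [NeZero m] {a b : ℤ} (h1 : a ≤ b) (h2 : b < a + m) :
    dl ((a : ZMod m), (b : ZMod m)) = b - a := by
  unfold dl
  simp only
  rw [← Int.cast_sub, ZMod.val_intCast]
  exact Int.emod_eq_of_lt (by omega) (by omega)

theorem darts_card {m : ℕ} [NeZero m] {T : Set (Sym2 (ZMod m))} (hv : PolyValid T) :
    (darts T).card = 2 * T.ncard := by
  classical
  have hfin : T.Finite := Set.toFinite T
  rw [Set.ncard_eq_toFinset_card T hfin]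
  rw [Finset.card_eq_sum_card_fiberwise (f := fun p : ZMod m × ZMod m => s(p.1, p.2))
    (t := hfin.toFinset)]
  · rw [Finset.sum_const_nat (m := 2), mul_comm]
    intro e he
    rw [Set.Finite.mem_toFinset] at he
    have hd := hv e he
    induction e using Sym2.ind with
    | _ x y =>
      have hxy : x ≠ y := by simpa using hd
      rw [Finset.card_eq_two]
      refine ⟨(x, y), (y, x), fun h => hxy (Prod.ext_iff.1 h).1, ?_⟩
      ext ⟨u, v⟩
      simp only [Finset.mem_filter, mem_darts, Finset.mem_insert, Finset.mem_singleton,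
        Prod.mk.injEq]
      constructor
      · rintro ⟨-, h⟩
        exact Sym2.eq_iff.1 h
      · intro h
        have : s(u, v) = s(x, y) := Sym2.eq_iff.2 h
        exact ⟨this ▸ he, this⟩
  · intro p hp
    simpa [mem_darts] using hp

theorem dl_swap {m : ℕ} [NeZero m] {x y : ZMod m} (h : x ≠ y) : dl (x, y) + dl (y, x) = m := by
  unfold dl
  simp only
  have h0 : y - x ≠ 0 := sub_ne_zero.2 h.symm
  have : x - y = -(y - x) := by ring
  rw [this, ZMod.neg_val, if_neg h0]
  have := ZMod.val_lt (y - x)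
  omega

theorem darts_sum {m : ℕ} [NeZero m] {T : Set (Sym2 (ZMod m))} (hv : PolyValid T) :
    2 * ∑ p ∈ darts T, dl p = m * (darts T).card := by
  have h1 : ∑ p ∈ darts T, dl p = ∑ p ∈ darts T, dl p.swap := by
    refine Finset.sum_nbij' Prod.swap Prod.swap ?_ ?_ ?_ ?_ ?_
    · intro p hp; rw [mem_darts] at *; simpa [Sym2.eq_swap] using hp
    · intro p hp; rw [mem_darts] at *; simpa [Sym2.eq_swap] using hp
    · intro p _; simp
    · intro p _; simp
    · intro p _; simp
  have h2 : ∑ p ∈ darts T, dl p + ∑ p ∈ darts T, dl p.swap = ∑ p ∈ darts T, (m : ℤ) := by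
    rw [← Finset.sum_add_distrib]
    refine Finset.sum_congr rfl ?_
    rintro ⟨x, y⟩ hp
    rw [mem_darts] at hp
    have hxy : x ≠ y := by simpa using hv _ hp
    exact dl_swap hxy
  rw [← h1] at h2
  rw [two_mul, h2, Finset.sum_const, nsmul_eq_mul, mul_comm]

theorem darts_diff_card {m : ℕ} [NeZero m] {T : Set (Sym2 (ZMod m))} (k : ZMod m)
    (h : ∀ x : ZMod m, s(x, x + k) ∈ T) :
    ((darts T).filter (fun p => p.2 - p.1 = k)).card = m := by
  classical
  have : (darts T).filter (fun p => p.2 - p.1 = k) =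
      Finset.univ.image (fun x : ZMod m => (x, x + k)) := by
    ext ⟨x, y⟩
    simp only [Finset.mem_filter, mem_darts, Finset.mem_image, Finset.mem_univ, true_and,
      Prod.mk.injEq]
    constructor
    · rintro ⟨_, h⟩
      exact ⟨x, rfl, by rw [← h]; ring⟩
    · rintro ⟨z, rfl, rfl⟩
      exact ⟨h _, by ring⟩
  rw [this, Finset.card_image_of_injective, Finset.card_univ, ZMod.card]
  intro x y h
  exact (Prod.ext_iff.1 h).1

/-- `r` is a star lifting the dart `p`. -/
def StarRep {m : ℕ} (T : Set (Sym2 (ZMod m))) (p : ZMod m × ZMod m) (r : ℤ → ℤ) : Prop :=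
  IsStar m (ET T) r ∧ p = ((r 0 : ZMod m), (r 2 : ZMod m))

theorem StarRep.uniq {m : ℕ} {T : Set (Sym2 (ZMod m))} (h : Sys m (ET T)) {p : ZMod m × ZMod m}
    {r s : ℤ → ℤ} (hr : StarRep T p r) (hs : StarRep T p s) : ∃ c : ℤ, ∀ k, s k = r k + m * c := by
  obtain ⟨hr, h1⟩ := hr
  obtain ⟨hs, h2⟩ := hs
  rw [h1] at h2
  have hm : (0 : ℤ) < m := by have := h.hN; omega
  obtain ⟨c, hc⟩ := cast_eq_iff.1 (Prod.ext_iff.1 h2).1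
  obtain ⟨d, hd⟩ := cast_eq_iff.1 (Prod.ext_iff.1 h2).2
  obtain ⟨a0, a1, a2, a3, a4, a5, -⟩ := hr.facts
  obtain ⟨b0, b1, b2, b3, b4, b5, -⟩ := hs.facts
  have e1 : (c - d) * m < m := by linarith
  have e2 : (d - c) * m < m := by linarith
  have := mul_lt_one hm e1
  have := mul_lt_one hm e2
  have : c = d := by omega
  subst this
  have := star_unique (hr.shift (h.inv c)) hs (by linarith) (by linarith)
  exact ⟨c, fun k => (congrFun this k).symm⟩

theorem tri_card {m : ℕ} (hm : 8 ≤ m) {T : Set (Sym2 (ZMod m))} (hT : IsPolyTriangulation T) :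
    (T.ncard : ℤ) = 4 * m - 10 := by
  classical
  have : NeZero m := ⟨by omega⟩
  have : Fact (1 < m) := ⟨by omega⟩
  have h := sys_of_cf (by omega) hT.2.1
  have mx := mx_of (by omega) hT
  have hv := hT.1
  have v1 : (1 : ZMod m).val = 1 := ZMod.val_one m
  have v2 : (2 : ZMod m).val = 2 := by
    have := ZMod.val_natCast_of_lt (n := m) (a := 2) (by omega)
    simpa using this
  have n1 : (1 : ZMod m) ≠ 0 := fun h => by rw [h] at v1; simp at v1
  have n2 : (2 : ZMod m) ≠ 0 := fun h => by rw [h] at v2; simp at v2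
  have w1 : (-1 : ZMod m).val = m - 1 := by rw [ZMod.neg_val, if_neg n1, v1]
  have w2 : (-2 : ZMod m).val = m - 2 := by rw [ZMod.neg_val, if_neg n2, v2]
  have l1 : ∀ x : ZMod m, s(x, x + 1) ∈ T := by
    intro x
    have := h.len1 mx x.val
    unfold ET at this; simpa using this
  have l2 : ∀ x : ZMod m, s(x, x + 2) ∈ T := by
    intro x
    have := h.len2 mx x.val
    unfold ET at this; simpa using this
  have c1 := darts_diff_card 1 l1
  have c2 := darts_diff_card (T := T) (-1) (fun x => by
    have := l1 (x - 1); rw [Sym2.eq_swap] at this; simpa [sub_eq_add_neg] using this)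
  have c3 := darts_diff_card (T := T) (-2) (fun x => by
    have := l2 (x - 2); rw [Sym2.eq_swap] at this; simpa [sub_eq_add_neg] using this)
  obtain ⟨D, hD⟩ : ∃ D : Finset (ZMod m × ZMod m), D = (darts T).filter
    (fun p => ¬ (p.2 - p.1 = 1) ∧ ¬ (p.2 - p.1 = -1) ∧ ¬ (p.2 - p.1 = -2)) := ⟨_, rfl⟩
  have split : ∀ F : ZMod m × ZMod m → ℤ, ∑ p ∈ darts T, F p = ∑ p ∈ D, F p +
      ∑ p ∈ (darts T).filter (fun p => p.2 - p.1 = 1), F p +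
      ∑ p ∈ (darts T).filter (fun p => p.2 - p.1 = -1), F p +
      ∑ p ∈ (darts T).filter (fun p => p.2 - p.1 = -2), F p := by
    intro F
    rw [hD]
    simp only [Finset.sum_filter]
    rw [← Finset.sum_add_distrib, ← Finset.sum_add_distrib, ← Finset.sum_add_distrib]
    refine Finset.sum_congr rfl ?_
    intro p _
    have d12 : (1 : ZMod m) ≠ -1 := fun h => by rw [← h, v1] at w1; omega
    have d13 : (1 : ZMod m) ≠ -2 := fun h => by rw [← h, v1] at w2; omega
    have d23 : (-1 : ZMod m) ≠ -2 := fun h => by rw [h, w2] at w1; omega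
    by_cases q1 : p.2 - p.1 = 1
    · simp [q1, d12, d13]
    by_cases q2 : p.2 - p.1 = -1
    · simp [q2, d12.symm, d23]
    by_cases q3 : p.2 - p.1 = -2
    · simp [q3, d13.symm, d23.symm]
    simp [q1, q2, q3]
  have sc := split (fun _ => 1)
  have sl := split dl
  have const : ∀ k : ZMod m, ∑ p ∈ (darts T).filter (fun p => p.2 - p.1 = k), dl p =
      ((darts T).filter (fun p => p.2 - p.1 = k)).card * (k.val : ℤ) := by
    intro k
    rw [← nsmul_eq_mul, ← Finset.sum_const]
    refine Finset.sum_congr rfl ?_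
    intro p hp
    rw [Finset.mem_filter] at hp
    unfold dl; rw [hp.2]
  rw [const, const, const, c1, c2, c3, v1, w1, w2] at sl
  simp only [Finset.sum_const, c1, c2, c3, nsmul_eq_mul, mul_one] at sc
  have dsum := darts_sum hv
  have dcard := darts_card hv
  -- star reps
  have mD : ∀ p r, StarRep T p r → p ∈ D ∧ dl p = r 2 - r 0 := by
    rintro p r ⟨hr, rfl⟩
    obtain ⟨a0, a1, a2, a3, a4, a5, -⟩ := hr.facts
    have hl := dl_cast (m := m) (a := r 0) (b := r 2) (by omega) (by omega)
    refine ⟨?_, hl⟩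
    rw [hD, Finset.mem_filter, mem_darts]
    refine ⟨hr.edge 0, ?_⟩
    unfold dl at hl
    simp only at hl ⊢
    refine ⟨?_, ?_, ?_⟩
    · intro hh; rw [hh, v1] at hl; omega
    · intro hh; rw [hh, w1] at hl; omega
    · intro hh; rw [hh, w2] at hl; omega
  have exD : ∀ p ∈ D, ∃ r, StarRep T p r := by
    rintro ⟨x, y⟩ hp
    rw [hD, Finset.mem_filter, mem_darts] at hp
    obtain ⟨hp, q1, q2, q3⟩ := hp
    simp only at hp q1 q2 q3
    have hxy : x ≠ y := by simpa using hv _ hp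
    have q0 : y - x ≠ 0 := sub_ne_zero.2 hxy.symm
    have t0 : (y - x).val ≠ 0 := fun e => q0 ((ZMod.val_eq_zero _).1 e)
    have t1 : (y - x).val ≠ 1 := fun e => q1 (ZMod.val_injective m (by rw [e, v1]))
    have t2 : (y - x).val ≠ m - 1 := fun e => q2 (ZMod.val_injective m (by rw [e, w1]))
    have t3 : (y - x).val ≠ m - 2 := fun e => q3 (ZMod.val_injective m (by rw [e, w2]))
    have := ZMod.val_lt (y - x)
    have ex : (((x.val : ℤ) : ZMod m)) = x := by simp
    have ey : (((x.val : ℤ) + ((y - x).val : ℤ) : ℤ) : ZMod m) = y := by simp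
    obtain ⟨r, hr, r0, r2⟩ := star_exists h mx (a := x.val) (b := x.val + (y - x).val) (by omega)
      (by omega) (by unfold ET; rw [ey, ex]; exact hp)
    exact ⟨r, hr, by rw [r0, r2, ey, ex]⟩
  choose! ρ hρ using exD
  obtain ⟨φ, hφ⟩ : ∃ φ : ZMod m × ZMod m → ZMod m × ZMod m,
    φ = fun p => ((ρ p 2 : ZMod m), (ρ p 4 : ZMod m)) := ⟨_, rfl⟩
  have step : ∀ p r, StarRep T p r → StarRep T (φ p) (fun k => r (k + 2)) := by
    intro p r hr
    obtain ⟨c, hc⟩ := hr.uniq h (hρ p (mD p r hr).1)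
    refine ⟨hr.1.reindex 2, ?_⟩
    rw [hφ]; simp [hc]
  have five : ∀ p r, StarRep T p r → φ (φ (φ (φ (φ p)))) = p ∧
      dl p + dl (φ p) + dl (φ (φ p)) + dl (φ (φ (φ p))) + dl (φ (φ (φ (φ p)))) = 2 * m := by
    intro p r hr
    have h1 := step _ _ hr
    have h2 := step _ _ h1
    have h3 := step _ _ h2
    have h4 := step _ _ h3
    have h5 := step _ _ h4
    have e0 := (mD _ _ hr).2
    have e1 := (mD _ _ h1).2
    have e2 := (mD _ _ h2).2
    have e3 := (mD _ _ h3).2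
    have e4 := (mD _ _ h4).2
    have z := hr.1.perz 0 2
    have z2 := hr.1.perz 2 2
    norm_num at e0 e1 e2 e3 e4 z z2
    constructor
    · rw [h5.2, hr.2]; norm_num; rw [z, z2]; simp
    · rw [e0, e1, e2, e3, e4]; linarith
  have inv : ∀ F : ZMod m × ZMod m → ℤ, ∑ p ∈ D, F (φ p) = ∑ p ∈ D, F p := by
    intro F
    have st : ∀ p ∈ D, φ p ∈ D := fun p hp => (mD _ _ (step _ _ (hρ p hp))).1
    refine Finset.sum_nbij' φ (fun p => φ (φ (φ (φ p)))) ?_ ?_ ?_ ?_ ?_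
    · exact st
    · intro p hp; exact st _ (st _ (st _ (st _ hp)))
    · intro p hp; exact (five _ _ (hρ p hp)).1
    · intro p hp; exact (five _ _ (hρ p hp)).1
    · intro p _; rfl
  have i1 := inv dl
  have i2 := inv (fun p => dl (φ p))
  have i3 := inv (fun p => dl (φ (φ p)))
  have i4 := inv (fun p => dl (φ (φ (φ p))))
  have tot : ∑ p ∈ D, (dl p + dl (φ p) + dl (φ (φ p)) + dl (φ (φ (φ p))) + dl (φ (φ (φ (φ p))))) =
      ∑ p ∈ D, (2 * m : ℤ) :=
    Finset.sum_congr rfl (fun p hp => (five _ _ (hρ p hp)).2)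
  simp only [Finset.sum_add_distrib, Finset.sum_const, nsmul_eq_mul] at tot
  rw [i4, i3, i2, i1] at tot
  have hm0 : (m : ℤ) ≠ 0 := by omega
  have dc : ((darts T).card : ℤ) = 2 * T.ncard := by rw [dcard]; push_cast; ring
  rw [dc] at sc dsum
  have hm1 : ((m - 1 : ℕ) : ℤ) = m - 1 := by omega
  have hm2 : ((m - 2 : ℕ) : ℤ) = m - 2 := by omega
  rw [hm1, hm2] at sl
  push_cast at sl
  apply mul_left_cancel₀ hm0
  have a1 : (D.card : ℤ) = 2 * T.ncard - 3 * m := by linarith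
  rw [a1] at tot
  linarith

theorem tri_of_card {m : ℕ} (hm : 8 ≤ m) {T : Set (Sym2 (ZMod m))} (hv : PolyValid T)
    (h : Sys m (ET T)) (hc : (T.ncard : ℤ) = 4 * m - 10) : IsPolyTriangulation T := by
  have : NeZero m := ⟨by omega⟩
  refine ⟨hv, cf_of_sys hv h, ?_⟩
  intro T' hv' hc' hsub
  obtain ⟨M, hM, hmax⟩ := Finite.exists_le_maximal
    (p := fun X : Set (Sym2 (ZMod m)) => PolyValid X ∧ PolyCrossingFree 3 X) ⟨hv', hc'⟩
  have hMt : IsPolyTriangulation M := by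
    refine ⟨hmax.prop.1, hmax.prop.2, ?_⟩
    intro X h1 h2 h3
    exact (hmax.eq_of_le ⟨h1, h2⟩ h3).symm
  have := tri_card hm hMt
  have hTM : T = M := Set.eq_of_subset_of_ncard_le (hsub.trans hM) (by omega) (Set.toFinite M)
  exact (Set.Subset.antisymm (hTM ▸ hM) hsub)
end count

end PartE

section PartF
theorem Sys.sub {m : ℕ} {X T : Set (Sym2 (ZMod m))} (h : Sys m (ET T)) (hX : X ⊆ T) :
    Sys m (ET X) where
  hN := h.hN
  symm := fun e => by unfold ET at *; rwa [Sym2.eq_swap]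
  per := fun e => by unfold ET at *; simpa using e
  per' := fun e => by unfold ET at *; simpa using e
  cf := fun l1 l2 l3 l4 l5 l6 e1 e2 e3 => h.cf l1 l2 l3 l4 l5 l6 (hX e1) (hX e2) (hX e3)

/-- Equality of stars up to reindexing and the period. -/
def Eqv (N : ℤ) (A B : ℤ → ℤ) : Prop := ∃ j c : ℤ, ∀ k, A k = B (k + j) + N * c

theorem flip_step {m : ℕ} {T : Set (Sym2 (ZMod m))} (h : Sys m (ET T)) {R S : ℤ → ℤ} {t : ℤ}
    (c : Cfg m (ET T) R S t) {T' : Set (Sym2 (ZMod m))}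
    (hT' : T' = (T \ {s((R 0 : ZMod m), (R 2 : ZMod m))}) ∪ {s((R t : ZMod m), (S t : ZMod m))}) :
    Sys m (ET T') ∧ T'.ncard = T.ncard ∧
    ∀ A, IsStar m (ET T) A → ¬ Eqv m A R → ¬ Eqv m A S → IsStar m (ET T') A := by
  have hm : 0 < m := by have := h.hN; omega
  have : NeZero m := ⟨by omega⟩
  have he : s((R 0 : ZMod m), (R 2 : ZMod m)) ∈ T := c.hR.edge 0
  have hf : s((R t : ZMod m), (S t : ZMod m)) ∉ T := c.nonedge
  obtain ⟨a0, a1, a2, a3, a4, a5, a6, a7⟩ := c.hR.facts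
  have z0 := c.h0
  have z2 := c.h2
  refine ⟨?_, ?_, ?_⟩
  · rw [hT']
    refine sys_insert (h.sub Set.sdiff_subset) ?_
    rintro f rfl
    refine ⟨_, _, c.lt.1, c.lt.2, rfl, ?_⟩
    intro g1 h1 g2 h2 l1 l2 l3 l4 l5 l6 eg eh
    have eg' := eg.resolve_right (fun eg => ne_of_inter l1 (by omega) l4 (by omega) eg)
    have eh' := eh.resolve_right (fun eh => ne_of_inter (by omega) l3 (by omega) l6 eh)
    refine c.core h l1 l2 l3 l4 l5 l6 eg'.1 eh'.1 ?_ ?_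
    · rintro ⟨rfl, rfl⟩; exact eg'.2 (by simp)
    · rintro ⟨rfl, rfl⟩; exact eh'.2 (by simp)
  · rw [hT', Set.union_singleton, Set.ncard_exchange hf he]
  · intro A hA nR nS
    rw [hT']
    refine ⟨hA.mono, hA.per, ?_, ?_⟩
    · intro i
      left
      refine ⟨hA.edge i, fun heq => ?_⟩
      obtain ⟨b0, b1, b2, b3, b4, b5, -⟩ := (hA.reindex i).facts
      rw [zero_add] at b0 b4 b5
      rw [Set.mem_singleton_iff, add_comm i 2] at heq
      obtain ⟨k, ⟨h1, h2⟩ | ⟨h1, h2⟩⟩ := edge_eq hm (by omega) (by omega) (by omega) (by omega) heq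
      · have := star_unique (hA.reindex i) (c.hR.shift (h.inv k)) (by simp only [zero_add]; linarith)
          (by linarith)
        apply nR
        refine ⟨-i, k, fun x => ?_⟩
        have := congrFun this (x + -i)
        simpa using this
      · have := star_unique (hA.reindex i) (c.hS.shift (h.inv k)) (by simp only [zero_add]; linarith)
          (by linarith)
        apply nS
        refine ⟨-i, k, fun x => ?_⟩
        have := congrFun this (x + -i)
        simpa using this
    · intro i w w1 w2 e
      rcases e with e | heq
      · exact hA.emp i w w1 w2 e.1
      obtain ⟨b0, b1, b2, b3, b4, b5, -⟩ := (hA.reindex i).facts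
      rw [zero_add] at b0 b4 b5
      rw [add_comm i 2] at w1
      rw [add_comm i 3] at w2
      obtain ⟨k, ⟨h1, h2⟩ | ⟨h1, h2⟩⟩ := edge_eq hm c.lt.1 c.lt.2 (by omega) (by omega) heq
      · have l := c.angleR
        rw [add_comm t 2, add_comm t 3] at l
        have := star_unique_angle (hA.reindex i) ((c.hR.reindex t).shift (h.inv k))
          (by simp only [zero_add]; linarith) (w := w) w1 w2 (by linarith) (by linarith)
        apply nR
        refine ⟨t - i, k, fun x => ?_⟩
        have := congrFun this (x + -i)
        simp only [neg_add_cancel_right] at this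
        rw [this]; ring_nf
      · have l := c.angleS
        rw [add_comm t 2, add_comm t 3] at l
        have := star_unique_angle (hA.reindex i) ((c.hS.reindex t).shift (h.inv k))
          (by simp only [zero_add]; linarith) (w := w) w1 w2 (by linarith) (by linarith)
        apply nS
        refine ⟨t - i, k, fun x => ?_⟩
        have := congrFun this (x + -i)
        simp only [neg_add_cancel_right] at this
        rw [this]; ring_nf

/-- Independence of two shifts of the pair `(R, S)`. -/
def Ind (N : ℤ) (R S : ℤ → ℤ) (d d' : ℤ) : Prop :=
  ¬ Eqv N (fun k => R k + d') (fun k => R k + d) ∧ ¬ Eqv N (fun k => R k + d') (fun k => S k + d) ∧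
  ¬ Eqv N (fun k => S k + d') (fun k => R k + d) ∧ ¬ Eqv N (fun k => S k + d') (fun k => S k + d)

theorem seq_flip {m : ℕ} {R S : ℤ → ℤ} {t : ℤ} (ds : List ℤ) (hp : ds.Pairwise (Ind m R S)) :
    ∀ T : Set (Sym2 (ZMod m)), Sys m (ET T) →
    (∀ d ∈ ds, Cfg m (ET T) (fun k => R k + d) (fun k => S k + d) t) →
    Sys m (ET ((T \ {x | ∃ d ∈ ds, x = s(((R 0 + d : ℤ) : ZMod m), ((R 2 + d : ℤ) : ZMod m))}) ∪
      {x | ∃ d ∈ ds, x = s(((R t + d : ℤ) : ZMod m), ((S t + d : ℤ) : ZMod m))})) ∧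
    ((T \ {x | ∃ d ∈ ds, x = s(((R 0 + d : ℤ) : ZMod m), ((R 2 + d : ℤ) : ZMod m))}) ∪
      {x | ∃ d ∈ ds, x = s(((R t + d : ℤ) : ZMod m), ((S t + d : ℤ) : ZMod m))}).ncard =
      T.ncard := by
  induction ds with
  | nil => intro T h _; simpa using h
  | cons d ds ih =>
    intro T h hc
    rw [List.pairwise_cons] at hp
    have c := hc d (by simp)
    obtain ⟨T1, hT1⟩ : ∃ T1, T1 = (T \ {s(((R 0 + d : ℤ) : ZMod m), ((R 2 + d : ℤ) : ZMod m))}) ∪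
      {s(((R t + d : ℤ) : ZMod m), ((S t + d : ℤ) : ZMod m))} := ⟨_, rfl⟩
    obtain ⟨s1, s2, s3⟩ := flip_step h c hT1
    obtain ⟨r1, r2⟩ := ih hp.2 T1 s1 (by
      intro d' hd'
      have c' := hc d' (by simp [hd'])
      obtain ⟨i1, i2, i3, i4⟩ := hp.1 d' hd'
      exact ⟨s3 _ c'.hR i1 i2, s3 _ c'.hS i3 i4, c'.h0, c'.h2, c'.ht⟩)
    have key : ((T \ {x | ∃ d' ∈ d :: ds, x = s(((R 0 + d' : ℤ) : ZMod m), ((R 2 + d' : ℤ) : ZMod m))}) ∪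
      {x | ∃ d' ∈ d :: ds, x = s(((R t + d' : ℤ) : ZMod m), ((S t + d' : ℤ) : ZMod m))}) =
      ((T1 \ {x | ∃ d ∈ ds, x = s(((R 0 + d : ℤ) : ZMod m), ((R 2 + d : ℤ) : ZMod m))}) ∪
      {x | ∃ d ∈ ds, x = s(((R t + d : ℤ) : ZMod m), ((S t + d : ℤ) : ZMod m))}) := by
      have nf : s(((R t + d : ℤ) : ZMod m), ((S t + d : ℤ) : ZMod m)) ∉ T := c.nonedge
      have ne : ∀ d' ∈ ds, s(((R 0 + d' : ℤ) : ZMod m), ((R 2 + d' : ℤ) : ZMod m)) ∈ T :=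
        fun d' hd' => (hc d' (by simp [hd'])).hR.edge 0
      ext x
      simp only [hT1, Set.mem_union, Set.mem_sdiff, Set.mem_setOf_eq, List.mem_cons,
        Set.mem_singleton_iff, exists_eq_or_imp, not_or]
      constructor
      · rintro (⟨h1, h2, h3⟩ | h1 | h1)
        · exact Or.inl ⟨Or.inl ⟨h1, h2⟩, h3⟩
        · refine Or.inl ⟨Or.inr h1, ?_⟩
          rintro ⟨d', hd', h2⟩
          exact nf (h1 ▸ h2 ▸ ne d' hd')
        · exact Or.inr h1
      · rintro (⟨⟨h1, h2⟩ | h1, h3⟩ | h1)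
        · exact Or.inl ⟨h1, h2, h3⟩
        · exact Or.inr (Or.inl h1)
        · exact Or.inr (Or.inr h1)
    rw [key]
    exact ⟨r1, r2.trans s2⟩

theorem mem_tilde {n : ℕ} {a b : ℤ} {x : Sym2 (ZMod (4 * n))} :
    x ∈ tilde n s((a : ZMod (4 * n)), (b : ZMod (4 * n))) ↔ ∃ i : ℕ, i < 4 ∧
      x = s(((a + i * n : ℤ) : ZMod (4 * n)), ((b + i * n : ℤ) : ZMod (4 * n))) := by
  unfold tilde
  simp only [Set.mem_insert_iff, Set.mem_singleton_iff, Sym2.map_mk]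
  constructor
  · rintro (h | h | h | h)
    · exact ⟨0, by omega, by rw [h]; simp⟩
    · exact ⟨1, by omega, by rw [h]; simp⟩
    · exact ⟨2, by omega, by rw [h]; simp⟩
    · exact ⟨3, by omega, by rw [h]; simp⟩
  · rintro ⟨i, hi, h⟩
    interval_cases i
    · left; rw [h]; simp
    · right; left; rw [h]; simp
    · right; right; left; rw [h]; simp
    · right; right; right; rw [h]; simp

theorem mem_tilde' {n : ℕ} {a b : ℤ} {x : Sym2 (ZMod (4 * n))} :
    x ∈ tilde n s((a : ZMod (4 * n)), (b : ZMod (4 * n))) ↔ ∃ i : ℤ,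
      x = s(((a + i * n : ℤ) : ZMod (4 * n)), ((b + i * n : ℤ) : ZMod (4 * n))) := by
  rw [mem_tilde]
  constructor
  · rintro ⟨i, -, h⟩; exact ⟨i, by rw [h]⟩
  · rintro ⟨i, h⟩
    refine ⟨(i % 4).toNat, by omega, ?_⟩
    have e : ∀ a : ℤ, ((a + i * n : ℤ) : ZMod (4 * n)) =
        ((a + ((i % 4).toNat : ℤ) * n : ℤ) : ZMod (4 * n)) := by
      intro a
      rw [cast_eq_iff]
      refine ⟨-(i / 4), ?_⟩
      have h1 : ((i % 4).toNat : ℤ) = i - 4 * (i / 4) := by omega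
      rw [h1]; push_cast; ring
    rw [h, e, e]

theorem tilde_ncard {n : ℕ} (hn : 0 < n) {a b : ℤ} (h1 : a < b) (h2 : b < a + 4 * n)
    (h3 : b - a ≠ 2 * n) : (tilde n s((a : ZMod (4 * n)), (b : ZMod (4 * n)))).ncard = 4 := by
  have : tilde n s((a : ZMod (4 * n)), (b : ZMod (4 * n))) = (fun i : ℕ =>
    s(((a + i * n : ℤ) : ZMod (4 * n)), ((b + i * n : ℤ) : ZMod (4 * n)))) '' (Set.Iio 4) := by
    ext x
    rw [mem_tilde]
    simp only [Set.mem_image, Set.mem_Iio, eq_comm]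
  rw [this, Set.ncard_image_of_injOn]
  · simp
  · intro i hi j hj hij
    simp only [Set.mem_Iio] at hi hj
    have hn' : (n : ℤ) ≠ 0 := by omega
    obtain ⟨k, ⟨q1, q2⟩ | ⟨q1, q2⟩⟩ := edge_eq (m := 4 * n) (by omega) (by omega)
      (by push_cast; omega) (by omega) (by push_cast; omega) hij
    · push_cast at q1
      have : (n : ℤ) * (i - j - 4 * k) = 0 := by linarith
      rcases mul_eq_zero.1 this with h | h
      · exact (hn' h).elim
      · omega
    · push_cast at q1 q2
      exact (h3 (by linarith)).elim

theorem tilde_per {n : ℕ} {e x : Sym2 (ZMod (4 * n))} :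
    x ∈ tilde n e ↔ Sym2.map (· + (n : ZMod (4 * n))) x ∈ tilde n e := by
  induction e using Sym2.ind with
  | _ y z =>
    obtain ⟨a, rfl⟩ := ZMod.intCast_surjective y
    obtain ⟨b, rfl⟩ := ZMod.intCast_surjective z
    rw [mem_tilde', mem_tilde']
    constructor
    · rintro ⟨i, rfl⟩
      refine ⟨i + 1, ?_⟩
      rw [Sym2.map_mk]; push_cast; ring_nf
    · rintro ⟨i, h⟩
      refine ⟨i - 1, ?_⟩
      have inj : Function.Injective (Sym2.map (· + (n : ZMod (4 * n)))) :=
        Sym2.map.injective (add_left_injective _)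
      apply inj
      rw [h, Sym2.map_mk]; push_cast; ring_nf

theorem finish {n : ℕ} (hn : 2 ≤ n) {T : Set (Sym2 (ZMod (4 * n)))}
    (hT : IsPeriodicPolyTriangulation n T) {e : Sym2 (ZMod (4 * n))} {u v : ℤ} (huv : u < v)
    (hvu : v < u + 4 * n)
    (h : Sys (4 * n : ℕ) (ET ((T \ tilde n e) ∪ tilde n s((u : ZMod (4 * n)), (v : ZMod (4 * n))))))
    (hc : ((T \ tilde n e) ∪ tilde n s((u : ZMod (4 * n)), (v : ZMod (4 * n)))).ncard = T.ncard) :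
    IsPeriodicPolyTriangulation n
      ((T \ tilde n e) ∪ tilde n s((u : ZMod (4 * n)), (v : ZMod (4 * n)))) := by
  refine ⟨tri_of_card (by omega) ?_ h (by rw [hc]; exact tri_card (by omega) hT.1), ?_⟩
  · rintro x (hx | hx)
    · exact hT.1.1 x hx.1
    · obtain ⟨i, -, rfl⟩ := mem_tilde.1 hx
      exact diag_ne (by omega) (by push_cast; omega)
  · intro x
    simp only [Set.mem_union, Set.mem_sdiff]
    rw [← tilde_per, ← tilde_per, ← hT.2]

theorem per_inv {n : ℕ} {T : Set (Sym2 (ZMod (4 * n)))} (h : PolyPeriodic n T) : Inv (ET T) n := by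
  intro a b
  unfold ET
  rw [h s((a : ZMod (4 * n)), (b : ZMod (4 * n)))]
  simp

theorem tilde_stab {n : ℕ} (e : Sym2 (ZMod (4 * n))) : Stab n (ET (tilde n e)) := by
  have hi : Inv (ET (tilde n e)) n := per_inv (fun x => tilde_per)
  have sh : ∀ (i : ℤ) {a b : ℤ}, ET (tilde n e) a b → ET (tilde n e) (a + n * i) (b + n * i) := by
    intro i
    induction i using Int.induction_on with
    | zero => intro a b e; simpa using e
    | succ i ih =>
      intro a b e
      have := (hi _ _).2 (ih e)
      rwa [add_assoc, add_assoc, show (n : ℤ) * i + n = n * (i + 1) by ring] at this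
    | pred i ih =>
      intro a b e
      rw [← hi, add_assoc, add_assoc, show (n : ℤ) * (-i - 1) + n = n * (-i) by ring]
      exact ih e
  refine ⟨fun e => by unfold ET at *; rwa [Sym2.eq_swap], ?_⟩
  intro i j a b c d e h1 h2
  have := sh i e
  rw [h1, h2]
  unfold ET at *
  have z : ((b + n * i + 4 * n * j : ℤ) : ZMod (4 * n)) = ((b + n * i : ℤ) : ZMod (4 * n)) := by
    symm; rw [cast_eq_iff]; exact ⟨j, by push_cast; ring⟩
  rw [z]; exact this

end PartF

section PartG
theorem tilde_cross {n : ℕ} (hn : 0 < n) {u v g1 g2 : ℤ} (q1 : n < v - u) (q2 : v - u < 3 * n)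
    (q3 : v - u ≠ 2 * n) (l1 : u < g1) (l2 : g1 < v) (l3 : v < g2) (l4 : g2 < u + 4 * n)
    (h : ET (tilde n s((u : ZMod (4 * n)), (v : ZMod (4 * n)))) g1 g2) :
    (g1 = u + n ∧ g2 = v + n) ∨ (g1 = v - n ∧ g2 = u + 3 * n) := by
  have hn' : (0 : ℤ) < n := by omega
  obtain ⟨i, -, hi⟩ := mem_tilde.1 h
  obtain ⟨k, h | h⟩ := edge_eq (m := 4 * n) (by omega) (by omega)
      (by push_cast; omega) (by omega) (by push_cast; omega) hi
  · left
    push_cast at h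
    obtain ⟨j, hj⟩ : ∃ j : ℤ, j = i + 4 * k := ⟨_, rfl⟩
    have e1 : g1 = u + j * n := by rw [hj]; linarith
    have e2 : g2 = v + j * n := by rw [hj]; linarith
    have p1 : 0 < j := by
      by_contra hh
      have := mul_nonpos_of_nonpos_of_nonneg (not_lt.1 hh) hn'.le
      linarith
    have p2 : j < 3 := by
      by_contra hh
      have := mul_le_mul_of_nonneg_right (not_lt.1 hh) hn'.le
      linarith
    have : j = 1 ∨ j = 2 := by omega
    rcases this with rfl | rfl
    · omega
    · omega
  · right
    push_cast at h
    obtain ⟨j, hj⟩ : ∃ j : ℤ, j = -(i + 4 * k) := ⟨_, rfl⟩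
    have e1 : g1 = v - j * n := by rw [hj]; linarith
    have e2 : g2 = u + 4 * n - j * n := by rw [hj]; linarith
    have p1 : 0 < j := by
      by_contra hh
      have := mul_nonpos_of_nonpos_of_nonneg (not_lt.1 hh) hn'.le
      linarith
    have p2 : j < 3 := by
      by_contra hh
      have := mul_le_mul_of_nonneg_right (not_lt.1 hh) hn'.le
      linarith
    have : j = 1 ∨ j = 2 := by omega
    rcases this with rfl | rfl
    · omega
    · omega

theorem final_q {n : ℕ} (hn : 2 ≤ n) {T : Set (Sym2 (ZMod (4 * n)))}
    (hT : IsPeriodicPolyTriangulation n T) {a b : ℤ} (hab : a < b) (hba : b < a + 4 * n)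
    (hl : b - a ≠ 2 * n) (he : ET T a b) {u v : ℤ}
    (q : QData n (ET T) (ET (tilde n s((a : ZMod (4 * n)), (b : ZMod (4 * n))))) u v) :
    ∃ f : Sym2 (ZMod (4 * n)), f ∉ T ∧ IsPeriodicPolyTriangulation n
      ((T \ tilde n s((a : ZMod (4 * n)), (b : ZMod (4 * n)))) ∪ tilde n f) := by
  have hN : ((4 * n : ℕ) : ℤ) = 4 * (n : ℤ) := by push_cast; rfl
  have : NeZero (4 * n) := ⟨by omega⟩
  have h := sys_of_cf (by omega) hT.1.2.1
  have hi : Inv (ET T) n := per_inv hT.2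
  have h4 := h
  rw [hN] at h4
  have hE := h4.stab hi
  have q1 := q.l1
  have q2 := q.l2
  have q3 := q.l3
  obtain ⟨e, hee⟩ : ∃ e, e = s((a : ZMod (4 * n)), (b : ZMod (4 * n))) := ⟨_, rfl⟩
  obtain ⟨f, hff⟩ : ∃ f, f = s((u : ZMod (4 * n)), (v : ZMod (4 * n))) := ⟨_, rfl⟩
  have ce : (tilde n e).ncard = 4 := by rw [hee]; exact tilde_ncard (by omega) hab hba hl
  have cf : (tilde n f).ncard = 4 := by
    rw [hff]; exact tilde_ncard (by omega) (by omega) (by omega) q3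
  have hO : Stab n (ET (tilde n e)) := tilde_stab e
  have hF : Stab n (ET (tilde n f)) := tilde_stab f
  rw [← hee] at q ⊢
  have subE : tilde n e ⊆ T := by
    intro x hx
    rw [hee] at hx
    obtain ⟨i, -, rfl⟩ := mem_tilde.1 hx
    exact hE.mv i 0 he (by ring) (by ring)
  have disF : Disjoint T (tilde n f) := by
    rw [Set.disjoint_left]
    intro x hx hx2
    rw [hff] at hx2
    obtain ⟨i, -, rfl⟩ := mem_tilde.1 hx2
    exact q.ne (hE.mv (-i) 0 hx (by ring) (by ring))
  have qb : ∀ g1 h1 g2 h2 : ℤ, u < g1 → g1 < h1 → h1 < v → v < g2 → g2 < h2 → h2 < u + 4 * n →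
      ET ((T \ tilde n e) ∪ tilde n f) g1 g2 → ET ((T \ tilde n e) ∪ tilde n f) h1 h2 → False := by
    intro g1 h1 g2 h2 l1 l2 l3 l4 l5 l6 eg eh
    rcases eg with eg | eg
    · rcases eh with eh | eh
      · exact q.q1 l1 l2 l3 l4 l5 l6 eg.1 eh.1 eg.2 eh.2
      · rcases tilde_cross (by omega) q1 q2 q3 (by omega : u < h1) l3 (by omega : v < h2) l6
          (hff ▸ eh) with ⟨k1, k2⟩ | ⟨k1, k2⟩
        · exact q.q2a l1 (by omega) l4 (by omega) eg.1 eg.2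
        · exact q.q2b (k1 := g1 + n) (k2 := g2 + n) (by omega) (by omega) (by omega) (by omega)
            (hE.mv 1 0 eg.1 (by omega) (by omega))
            (fun o => eg.2 (hO.mv (-1) 0 o (by omega) (by omega)))
    · have cg := tilde_cross (by omega) q1 q2 q3 (by omega : u < g1) (by omega) (by omega : v < g2)
          (by omega) (hff ▸ eg)
      rcases eh with eh | eh
      · rcases cg with ⟨k1, k2⟩ | ⟨k1, k2⟩
        · exact q.q2b (k1 := h1) (k2 := h2) (by omega) (by omega) (by omega) (by omega) eh.1 eh.2
        · exact q.q2a (k1 := h2 - 3 * n) (k2 := h1 + n) (by omega) (by omega) (by omega) (by omega)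
            (hE.mv (-3) 1 (hE.symm eh.1) (by omega) (by omega))
            (fun o => eh.2 (hO.symm (hO.mv 3 (-1) o (by omega) (by omega))))
      · rcases tilde_cross (by omega) q1 q2 q3 (by omega : u < h1) l3 (by omega : v < h2) l6
          (hff ▸ eh) with ⟨k1, k2⟩ | ⟨k1, k2⟩ <;> rcases cg with ⟨k3, k4⟩ | ⟨k3, k4⟩ <;> omega
  have sys : Sys (4 * n : ℕ) (ET ((T \ tilde n e) ∪ tilde n f)) := by
    refine sys_insert (h.sub Set.sdiff_subset) ?_
    intro x hx
    rw [hff] at hx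
    obtain ⟨i, -, rfl⟩ := mem_tilde.1 hx
    have bk : ∀ {x y : ℤ}, ET ((T \ tilde n e) ∪ tilde n f) x y →
        ET ((T \ tilde n e) ∪ tilde n f) (x - i * n) (y - i * n) := by
      rintro x y (⟨k1, k2⟩ | k1)
      · exact Or.inl ⟨hE.mv (-i) 0 k1 (by ring) (by ring),
          fun o => k2 (hO.mv i 0 o (by ring) (by ring))⟩
      · exact Or.inr (hF.mv (-i) 0 k1 (by ring) (by ring))
    refine ⟨_, _, by omega, by omega, rfl, ?_⟩
    intro g1 h1 g2 h2 l1 l2 l3 l4 l5 l6 eg eh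
    rw [hN] at l6
    exact qb (g1 - i * n) (h1 - i * n) (g2 - i * n) (h2 - i * n) (by linarith) (by linarith)
      (by linarith) (by linarith) (by linarith) (by linarith) (bk eg) (bk eh)
  refine ⟨f, hff ▸ q.ne, ?_⟩
  rw [hff] at sys cf disF ⊢
  refine finish hn hT (by omega) (by omega) sys ?_
  rw [Set.ncard_union_eq (disF.mono_left Set.sdiff_subset) (Set.toFinite _) (Set.toFinite _),
    cf]
  have := Set.ncard_sdiff_add_ncard_of_subset subE (Set.toFinite _)
  rw [ce] at this
  exact this

theorem q_pos {n : ℤ} (hn : 0 < n) {E : ℤ → ℤ → Prop} {R S : ℤ → ℤ} (hR : IsStar (4 * n) E R)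
    (hS : IsStar (4 * n) E S) (h0 : S 0 = R 2) (h2 : S 2 = R 0 + 4 * n) {j c : ℤ}
    (hj : ∀ k, S (k + j) = R k + n + 4 * n * c) :
    R 2 = R 1 + n ∧ R 3 = R 0 + 3 * n ∧ ∀ k, S (k - 1) = R k + n := by
  obtain ⟨a0, a1, a2, a3, a4, a5, a6, a7⟩ := hR.facts
  obtain ⟨i, hi⟩ : ∃ i, i = -(j - 5 * c) := ⟨_, rfl⟩
  have hj' : ∀ k, S (k - i) = R k + n := by
    intro k
    have e1 := hS.perz (k + j) (-c)
    rw [show k + j + 5 * -c = k - i by rw [hi]; ring, hj] at e1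
    linarith
  have mono : StrictMono R := strictMono_int_of_lt_succ hR.mono
  have k0 := hj' i
  have k2 := hj' (i + 2)
  rw [show i - i = 0 by ring] at k0
  rw [show i + 2 - i = 2 by ring] at k2
  have u1 : i < 2 := mono.lt_iff_lt.1 (by linarith)
  have u2 : i + 2 < 5 := mono.lt_iff_lt.1 (by linarith)
  have u3 : 0 < i + 2 := mono.lt_iff_lt.1 (by linarith)
  have am : R (-1) + 4 * n = R 4 := (hR.per (-1)).symm
  have : i = -1 ∨ i = 0 ∨ i = 1 := by omega
  rcases this with rfl | rfl | rfl
  · norm_num at k0 k2; omega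
  · norm_num at k0 k2; omega
  · norm_num at k0 k2; exact ⟨by omega, by omega, hj'⟩

theorem d_pos {n : ℤ} (hn : 0 < n) {E : ℤ → ℤ → Prop} {R S : ℤ → ℤ} (hR : IsStar (4 * n) E R)
    (hS : IsStar (4 * n) E S) (h0 : S 0 = R 2) (h2 : S 2 = R 0 + 4 * n) {j c : ℤ}
    (hj : ∀ k, S (k + j) = R k + 2 * n + 4 * n * c) : ∀ k, S k = R k + 2 * n := by
  obtain ⟨a0, a1, a2, a3, a4, a5, a6, a7⟩ := hR.facts
  obtain ⟨i, hi⟩ : ∃ i, i = -(j - 5 * c) := ⟨_, rfl⟩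
  have hj' : ∀ k, S (k - i) = R k + 2 * n := by
    intro k
    have e1 := hS.perz (k + j) (-c)
    rw [show k + j + 5 * -c = k - i by rw [hi]; ring, hj] at e1
    linarith
  have mono : StrictMono R := strictMono_int_of_lt_succ hR.mono
  have k0 := hj' i
  have k2 := hj' (i + 2)
  rw [show i - i = 0 by ring] at k0
  rw [show i + 2 - i = 2 by ring] at k2
  have u1 : i < 2 := mono.lt_iff_lt.1 (by linarith)
  have u2 : i + 2 < 5 := mono.lt_iff_lt.1 (by linarith)
  have u3 : 0 < i + 2 := mono.lt_iff_lt.1 (by linarith)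
  have am : R (-1) + 4 * n = R 4 := (hR.per (-1)).symm
  have : i = -1 ∨ i = 0 ∨ i = 1 := by omega
  rcases this with rfl | rfl | rfl
  · norm_num at k0 k2; omega
  · simpa using hj'
  · norm_num at k0 k2; omega

theorem case_q {n : ℕ} (hn : 2 ≤ n) {T : Set (Sym2 (ZMod (4 * n)))}
    (hT : IsPeriodicPolyTriangulation n T) {R S : ℤ → ℤ} (hR : IsStar (4 * n) (ET T) R)
    (hS : IsStar (4 * n) (ET T) S) (h0 : S 0 = R 2) (h2 : S 2 = R 0 + 4 * n) {j c : ℤ}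
    (hj : ∀ k, S (k + j) = R k + n + 4 * n * c) :
    ∃ f : Sym2 (ZMod (4 * n)), f ∉ T ∧ IsPeriodicPolyTriangulation n
      ((T \ tilde n s((R 0 : ZMod (4 * n)), (R 2 : ZMod (4 * n)))) ∪ tilde n f) := by
  obtain ⟨p1, p2, p3⟩ := q_pos (by omega) hR hS h0 h2 hj
  have hN : ((4 * n : ℕ) : ℤ) = 4 * (n : ℤ) := by push_cast; rfl
  have h := sys_of_cf (by omega) hT.1.2.1
  rw [hN] at h
  have hi : Inv (ET T) n := per_inv hT.2
  have hE := h.stab hi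
  obtain ⟨a0, a1, a2, a3, a4, a5, a6, a7⟩ := hR.facts
  have hx : R 1 ≠ R 0 + n := by
    intro hx
    have sh : IsStar (4 * n) (ET T) (fun k => R k + 2 * n) := by
      have := hR.shift (hi.add hi)
      rwa [← two_mul] at this
    have := star_unique sh hS (by omega) (by omega)
    refine star_no_sym (i := 1) (c := 0) (j := 1) (m := n) (by omega) hR (by omega) (by ring) ?_
    intro k
    have e1 := congrFun this k
    have e2 := p3 (k + 1)
    rw [show k + 1 - 1 = k by ring] at e2
    linarith
  obtain ⟨u, v, q⟩ := qcore h hi (tilde_stab s((R 0 : ZMod (4 * n)), (R 2 : ZMod (4 * n)))) hR p1 p2 hx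
    (by
      have : ET (tilde n s((R 0 : ZMod (4 * n)), (R 2 : ZMod (4 * n)))) (R 0) (R 2) :=
        mem_tilde.2 ⟨0, by omega, by simp⟩
      have st := tilde_stab s((R 0 : ZMod (4 * n)), (R 2 : ZMod (4 * n)))
      exact st.mv (-1) 1 (st.symm this) (by omega) (by omega))
  exact final_q hn hT (by omega) (by omega) (by omega) (hR.edge 0) q

theorem final_seq {n : ℕ} (hn : 2 ≤ n) {T : Set (Sym2 (ZMod (4 * n)))}
    (hT : IsPeriodicPolyTriangulation n T) {R S : ℤ → ℤ} {t : ℤ}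
    (c : Cfg (4 * n : ℕ) (ET T) R S t) (is : List ℕ)
    (hp : (is.map (fun i : ℕ => (i : ℤ) * n)).Pairwise (Ind (4 * n : ℕ) R S))
    (h1 : ∀ x, x ∈ tilde n s((R 0 : ZMod (4 * n)), (R 2 : ZMod (4 * n))) ↔
      ∃ i ∈ is, x = s(((R 0 + (i : ℤ) * n : ℤ) : ZMod (4 * n)), ((R 2 + (i : ℤ) * n : ℤ) : ZMod (4 * n))))
    (h2 : ∀ x, x ∈ tilde n s((R t : ZMod (4 * n)), (S t : ZMod (4 * n))) ↔
      ∃ i ∈ is, x = s(((R t + (i : ℤ) * n : ℤ) : ZMod (4 * n)), ((S t + (i : ℤ) * n : ℤ) : ZMod (4 * n)))) :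
    ∃ f : Sym2 (ZMod (4 * n)), f ∉ T ∧ IsPeriodicPolyTriangulation n
      ((T \ tilde n s((R 0 : ZMod (4 * n)), (R 2 : ZMod (4 * n)))) ∪ tilde n f) := by
  have hN : ((4 * n : ℕ) : ℤ) = 4 * (n : ℤ) := by push_cast; rfl
  have h := sys_of_cf (by omega) hT.1.2.1
  have hi : Inv (ET T) n := per_inv hT.2
  have hinv : ∀ i : ℕ, Inv (ET T) ((i : ℤ) * n) := by
    intro i
    induction i with
    | zero => intro a b; simp
    | succ i ih =>
      have := ih.add hi
      rw [show ((i + 1 : ℕ) : ℤ) * n = i * n + n by push_cast; ring]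
      exact this
  obtain ⟨s1, s2⟩ := seq_flip (t := t) _ hp T h (by
    intro d hd
    obtain ⟨i, -, rfl⟩ := List.mem_map.1 hd
    refine ⟨c.hR.shift (hinv i), c.hS.shift (hinv i), ?_, ?_, ?_⟩
    · have := c.h0; omega
    · have := c.h2; omega
    · have := c.ht; omega)
  refine ⟨s((R t : ZMod (4 * n)), (S t : ZMod (4 * n))), c.nonedge, ?_⟩
  have e1 : tilde n s((R 0 : ZMod (4 * n)), (R 2 : ZMod (4 * n))) =
      {x | ∃ d ∈ is.map (fun i : ℕ => (i : ℤ) * n),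
        x = s(((R 0 + d : ℤ) : ZMod (4 * n)), ((R 2 + d : ℤ) : ZMod (4 * n)))} := by
    ext x
    rw [h1]
    simp
  have e2 : tilde n s((R t : ZMod (4 * n)), (S t : ZMod (4 * n))) =
      {x | ∃ d ∈ is.map (fun i : ℕ => (i : ℤ) * n),
        x = s(((R t + d : ℤ) : ZMod (4 * n)), ((S t + d : ℤ) : ZMod (4 * n)))} := by
    ext x
    rw [h2]
    simp
  rw [← e1, ← e2] at s1 s2
  have := c.lt
  exact finish hn hT (by omega) (by omega) s1 s2

end PartG

section PartH
theorem ind_of {n : ℕ} (hn : 2 ≤ n) {E : ℤ → ℤ → Prop} {R S : ℤ → ℤ} (hR : IsStar (4 * n) E R)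
    (hS : IsStar (4 * n) E S) (i i' : ℕ) (hi : i < i') (hi' : i' < i + 4)
    (H1 : ∀ j c : ℤ, ¬ ∀ k, S (k + j) = R k + ((i' : ℤ) - i) * n + 4 * n * c)
    (H2 : ∀ j c : ℤ, ¬ ∀ k, S (k + j) = R k + (4 - ((i' : ℤ) - i)) * n + 4 * n * c) :
    Ind (4 * n : ℕ) R S ((i : ℤ) * n) ((i' : ℤ) * n) := by
  have hN : ((4 * n : ℕ) : ℤ) = 4 * (n : ℤ) := by push_cast; rfl
  rw [hN]
  refine ⟨?_, ?_, ?_, ?_⟩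
  · rintro ⟨j, c, h⟩
    refine star_no_sym (n := n) (i := (i' : ℤ) - i) (c := -c) (j := j) (by omega) hR (by omega) rfl ?_
    intro k
    have := h k
    simp only at this
    linarith
  · rintro ⟨j, c, h⟩
    refine H1 j (-c) ?_
    intro k
    have := h k
    simp only at this
    linarith
  · rintro ⟨j, c, h⟩
    refine H2 (-j) (c - 1) ?_
    intro k
    have := h (k + -j)
    simp only [neg_add_cancel_right] at this
    linarith
  · rintro ⟨j, c, h⟩
    refine star_no_sym (n := n) (i := (i' : ℤ) - i) (c := -c) (j := j) (by omega) hS (by omega) rfl ?_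
    intro k
    have := h k
    simp only at this
    linarith

theorem tilde_half {n : ℕ} {a b : ℤ} (h : b = a + 2 * n) (x : Sym2 (ZMod (4 * n))) :
    x ∈ tilde n s((a : ZMod (4 * n)), (b : ZMod (4 * n))) ↔
      ∃ i ∈ [0, 1], x = s(((a + ((i : ℕ) : ℤ) * n : ℤ) : ZMod (4 * n)),
        ((b + ((i : ℕ) : ℤ) * n : ℤ) : ZMod (4 * n))) := by
  rw [mem_tilde]
  constructor
  · rintro ⟨i, hi, rfl⟩
    have sw : ∀ i : ℤ, s(((a + (i + 2) * n : ℤ) : ZMod (4 * n)), ((b + (i + 2) * n : ℤ) : ZMod (4 * n)))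
        = s(((a + i * n : ℤ) : ZMod (4 * n)), ((b + i * n : ℤ) : ZMod (4 * n))) := by
      intro i
      rw [Sym2.eq_swap]
      have e1 : ((b + (i + 2) * n : ℤ) : ZMod (4 * n)) = ((a + i * n : ℤ) : ZMod (4 * n)) :=
        cast_eq_iff.2 ⟨-1, by push_cast; rw [h]; ring⟩
      have e2 : ((a + (i + 2) * n : ℤ) : ZMod (4 * n)) = ((b + i * n : ℤ) : ZMod (4 * n)) :=
        cast_eq_iff.2 ⟨0, by rw [h]; ring⟩
      rw [e1, e2]
    have : i = 0 ∨ i = 1 ∨ i = 2 ∨ i = 3 := by omega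
    rcases this with rfl | rfl | rfl | rfl
    · exact ⟨0, by simp, rfl⟩
    · exact ⟨1, by simp, rfl⟩
    · exact ⟨0, by simp, sw 0⟩
    · exact ⟨1, by simp, sw 1⟩
  · rintro ⟨i, hi, h⟩
    refine ⟨i, ?_, h⟩
    simp at hi
    omega

theorem tilde_full {n : ℕ} {a b : ℤ} (x : Sym2 (ZMod (4 * n))) :
    x ∈ tilde n s((a : ZMod (4 * n)), (b : ZMod (4 * n))) ↔
      ∃ i ∈ [0, 1, 2, 3], x = s(((a + ((i : ℕ) : ℤ) * n : ℤ) : ZMod (4 * n)),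
        ((b + ((i : ℕ) : ℤ) * n : ℤ) : ZMod (4 * n))) := by
  rw [mem_tilde]
  constructor
  · rintro ⟨i, hi, h⟩
    refine ⟨i, ?_, h⟩
    simp
    omega
  · rintro ⟨i, hi, h⟩
    refine ⟨i, ?_, h⟩
    simp at hi
    omega

theorem main_int {n : ℕ} (hn : 2 ≤ n) {T : Set (Sym2 (ZMod (4 * n)))}
    (hT : IsPeriodicPolyTriangulation n T) {a b : ℤ} (hab : a + 3 ≤ b) (hba : b ≤ a + 4 * n - 3)
    (he : ET T a b) :
    ∃ f : Sym2 (ZMod (4 * n)), f ∉ T ∧ IsPeriodicPolyTriangulation n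
      ((T \ tilde n s((a : ZMod (4 * n)), (b : ZMod (4 * n)))) ∪ tilde n f) := by
  have hN : ((4 * n : ℕ) : ℤ) = 4 * (n : ℤ) := by push_cast; rfl
  have h := sys_of_cf (by omega) hT.1.2.1
  have mx := mx_of (by omega) hT.1
  obtain ⟨R, hR, R0, R2⟩ := star_exists h mx (by omega) (by omega) he
  obtain ⟨S, hS, S0, S2⟩ := star_exists h mx (by omega) (by omega) (h.per (h.symm he))
  have hR' := hR
  have hS' := hS
  rw [hN] at hR' hS'
  have h0 : S 0 = R 2 := by omega
  have h2 : S 2 = R 0 + (4 * n : ℕ) := by omega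
  have h2' : S 2 = R 0 + 4 * n := by omega
  by_cases H1 : ∃ j c : ℤ, ∀ k, S (k + j) = R k + n + 4 * n * c
  · obtain ⟨j, c, H⟩ := H1
    have := case_q hn hT hR' hS' h0 h2' H
    rwa [R0, R2] at this
  by_cases H3 : ∃ j c : ℤ, ∀ k, S (k + j) = R k + 3 * n + 4 * n * c
  · obtain ⟨j, c, H⟩ := H3
    have hR'' := hR.shift (h.inv 1)
    rw [hN] at hR''
    have := case_q (j := -j) (c := -c) hn hT hS' hR'' (by omega) (by omega) (by
      intro k
      have := H (k + -j)
      simp only [neg_add_cancel_right] at this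
      linarith)
    rw [S0, S2, Sym2.eq_swap] at this
    have e1 : ((a + (4 * n : ℕ) : ℤ) : ZMod (4 * n)) = (a : ZMod (4 * n)) :=
      cast_eq_iff.2 ⟨-1, by ring⟩
    rwa [e1] at this
  obtain ⟨t, c⟩ := cfg_exists h hR hS h0 h2
  rw [← R0, ← R2]
  by_cases H2 : ∃ j c : ℤ, ∀ k, S (k + j) = R k + 2 * n + 4 * n * c
  · obtain ⟨j, c', H⟩ := H2
    have hs := d_pos (by omega) hR' hS' h0 h2' H
    refine final_seq hn hT c [0, 1] ?_ (tilde_half ?_) (tilde_half (hs t))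
    · simp only [List.map_cons, List.map_nil, List.pairwise_pair]
      refine ind_of hn hR' hS' 0 1 (by omega) (by omega) ?_ ?_
      · intro j c hh
        exact H1 ⟨j, c, fun k => by have := hh k; push_cast at this; linarith⟩
      · intro j c hh
        exact H3 ⟨j, c, fun k => by have := hh k; push_cast at this; linarith⟩
    · have := hs 0
      omega
  · have key : ∀ p : ℤ, p = 1 ∨ p = 2 ∨ p = 3 → ∀ j c : ℤ, ¬ ∀ k, S (k + j) = R k + p * n + 4 * n * c := by
      rintro p (rfl | rfl | rfl) j c hh
      · exact H1 ⟨j, c, by simpa using hh⟩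
      · exact H2 ⟨j, c, hh⟩
      · exact H3 ⟨j, c, hh⟩
    have ind : ∀ i i' : ℕ, i < i' → i' < i + 4 → Ind (4 * n : ℕ) R S ((i : ℤ) * n) ((i' : ℤ) * n) :=
      fun i i' l l' => ind_of hn hR' hS' i i' l l' (key _ (by omega)) (key _ (by omega))
    refine final_seq hn hT c [0, 1, 2, 3] ?_ tilde_full tilde_full
    rw [List.pairwise_map]
    have : List.Pairwise (fun i i' : ℕ => i < i' ∧ i' < i + 4) [0, 1, 2, 3] := by decide
    exact this.imp (fun hh => ind _ _ hh.1 hh.2)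

end PartH

/-- For every 2-relevant edge `e` of an `n`-periodic
2-triangulation `T` on the `4n`-gon, with rotation orbit `ẽ`, there exists an
edge `f ∉ T` with rotation orbit `f̃` such that `(T ∖ ẽ) ∪ f̃` is again an
`n`-periodic 2-triangulation on the `4n`-gon. -/
theorem flip_exists (n : ℕ) (hn : 1 ≤ n)
    (T : Set (Sym2 (ZMod (4 * n)))) (hT : IsPeriodicPolyTriangulation n T)
    (e : Sym2 (ZMod (4 * n))) (he : e ∈ T) (hrel : PolyRelevant n e) :
    ∃ f : Sym2 (ZMod (4 * n)), f ∉ T ∧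
      IsPeriodicPolyTriangulation n ((T \ tilde n e) ∪ tilde n f) := by
  obtain ⟨a, b, hab, hb, rfl, h1, h2⟩ := hrel
  have := main_int (n := n) (by omega) hT (a := a) (b := b) (by omega) (by omega)
    (by unfold ET; simpa using he)
  simpa using this


end Multitriangulation
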